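/- arXiv:1108.2866 — 4 statements merged into one kernel-verified Lean document; each statement's English description precedes it below -/
import Mathlib

section
/- Let G be a finite abelian group of rank 2, i.e. G ≅ C_{n1} ⊕ C_{n2} with 1 < n1 and n1 dividing n2. Then C_0(G) equals the full interval [D(G)+1, η(G)-1]. -/
/-- `S` contains a short zero-sum subsequence: a nonempty subsequence with sum `0`
whose length is at most `exp(G)`. -/
def HasShortZeroSumSubseq {G : Type*} [AddCommGroup G] (S : Multiset G) : Prop :=
  ∃ T, T ≤ S ∧ T.sum = 0 ∧ 1 ≤ Multiset.card T ∧ Multiset.card T ≤ AddMonoid.exponent G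

/-- `η G` : the smallest `d` such that every sequence over `G` of length at least `d`
contains a short zero-sum subsequence. -/
noncomputable def etaConst (G : Type*) [AddCommGroup G] : ℕ :=
  sInf {d : ℕ | ∀ S : Multiset G, d ≤ Multiset.card S → HasShortZeroSumSubseq S}

/-- `D G` : the Davenport constant, the smallest `d` such that every sequence over `G`
of length at least `d` contains a nonempty zero-sum subsequence. -/
noncomputable def davenport (G : Type*) [AddCommGroup G] : ℕ :=
  sInf {d : ℕ | ∀ S : Multiset G, d ≤ Multiset.card S → ∃ T, T ≤ S ∧ T ≠ 0 ∧ T.sum = 0}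

/-- `C₀(G)` : the set of `t ∈ [D(G)+1, η(G)-1]` such that every zero-sum sequence over
`G` of length exactly `t` contains a short zero-sum subsequence. -/
def C0 (G : Type*) [AddCommGroup G] : Set ℕ :=
  {t | davenport G + 1 ≤ t ∧ t ≤ etaConst G - 1 ∧
    ∀ S : Multiset G, Multiset.card S = t → S.sum = 0 → HasShortZeroSumSubseq S}

lemma exists_le_card_eq {β : Type*} {k : ℕ} {S : Multiset β} (h : k ≤ Multiset.card S) :
    ∃ T ≤ S, Multiset.card T = k := by
  obtain ⟨l, rfl⟩ := Quot.exists_rep S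
  exact ⟨(l.take k : List β), Multiset.coe_le.mpr (List.take_sublist _ _).subperm,
    by simpa using h⟩

/-- A multiset of at least `|H|` elements indexed into a finite abelian group `H` has a nonempty
subfamily with sum zero. -/
lemma exists_le_sum_map_eq_zero {β H : Type*} [AddCommGroup H] [Finite H] (F : Multiset β)
    (h : β → H) (hF : Nat.card H ≤ Multiset.card F) :
    ∃ A ≤ F, A ≠ 0 ∧ (A.map h).sum = 0 := by
  have := Fintype.ofFinite H
  obtain ⟨l, rfl⟩ := Quot.exists_rep F
  change Nat.card H ≤ l.length at hF
  obtain ⟨i, j, hij, heq⟩ := Fintype.exists_ne_map_eq_of_card_lt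
    (fun i : Fin (l.length + 1) => ((l.take i).map h).sum)
    (by rw [Fintype.card_fin, ← Nat.card_eq_fintype_card]; omega)
  wlog hlt : i < j generalizing i j
  · exact this j i hij.symm heq.symm (lt_of_le_of_ne (not_lt.mp hlt) hij.symm)
  refine ⟨((l.drop i).take (j - i) : List β),
    Multiset.coe_le.mpr ((List.take_sublist _ _).trans (List.drop_sublist _ _)).subperm, ?_, ?_⟩
  · rw [ne_eq, Multiset.coe_eq_zero, ← List.length_eq_zero_iff, List.length_take,
      List.length_drop]
    have := j.2
    have : (i : ℕ) < j := hlt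
    omega
  · have hsplit : l.take j = l.take i ++ (l.drop i).take (j - i) := by
      rw [← List.take_add]
      congr 1
      have : (i : ℕ) < j := hlt
      omega
    simp only [hsplit, List.map_append, List.sum_append] at heq
    rw [Multiset.map_coe, Multiset.sum_coe]
    simpa using heq

/-- Olson's bound for elementary abelian `p`-groups, from the Chevalley-Warning theorem. -/
lemma exists_finset_sum_eq_zero_of_prime {ι : Type*} [Fintype ι] (p d : ℕ) [Fact p.Prime]
    (v : ι → Fin d → ZMod p) (h : d * (p - 1) < Fintype.card ι) :
    ∃ A : Finset ι, A.Nonempty ∧ ∀ j, ∑ i ∈ A, v i j = 0 := by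
  classical
  have hp : 0 < p - 1 := Nat.sub_pos_of_lt (Fact.out : p.Prime).one_lt
  let f : Fin d → MvPolynomial ι (ZMod p) := fun j =>
    ∑ i, MvPolynomial.C (v i j) * MvPolynomial.X i ^ (p - 1)
  have hdeg : ∑ j, (f j).totalDegree < Fintype.card ι := by
    refine lt_of_le_of_lt (Finset.sum_le_card_nsmul _ _ (p - 1) fun j _ => ?_) (by simpa using h)
    refine MvPolynomial.totalDegree_finsetSum_le fun i _ => ?_
    refine (MvPolynomial.totalDegree_mul _ _).trans ?_
    simp [MvPolynomial.totalDegree_X_pow]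
  have hdvd := char_dvd_card_solutions_of_fintype_sum_lt p hdeg
  have heval : ∀ (x : ι → ZMod p) j,
      MvPolynomial.eval x (f j) = ∑ i with x i ≠ 0, v i j := by
    intro x j
    simp only [f, map_sum, map_mul, MvPolynomial.eval_C, map_pow, MvPolynomial.eval_X,
      Finset.sum_filter]
    refine Finset.sum_congr rfl fun i _ => ?_
    by_cases hx : x i = 0
    · simp [hx, hp.ne']
    · simp [hx, ZMod.pow_card_sub_one_eq_one hx]
  have hzero : ∀ j, MvPolynomial.eval (0 : ι → ZMod p) (f j) = 0 := fun j => by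
    rw [heval]
    simp
  rw [Fintype.card_eq_nat_card] at hdvd
  have hcard : 1 < Nat.card {x : ι → ZMod p // ∀ j, MvPolynomial.eval x (f j) = 0} :=
    lt_of_lt_of_le (Fact.out : p.Prime).one_lt
      (Nat.le_of_dvd (Nat.card_pos_iff.mpr ⟨⟨⟨0, hzero⟩⟩, inferInstance⟩) hdvd)
  have := Finite.one_lt_card_iff_nontrivial.mp hcard
  obtain ⟨⟨x, hx⟩, hne⟩ := exists_ne
    (⟨0, hzero⟩ : {x : ι → ZMod p // ∀ j, MvPolynomial.eval x (f j) = 0})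
  refine ⟨({i | x i ≠ 0} : Finset ι), ?_, fun j => by rw [← heval, hx]⟩
  obtain ⟨i, hi⟩ := Function.ne_iff.mp fun h0 => hne (Subtype.ext h0)
  exact ⟨i, by simpa using hi⟩

lemma exists_le_dvd_sum_of_prime {β : Type*} (p d : ℕ) (hp : p.Prime) (X : Multiset β)
    (u : Fin d → β → ℤ) (h : d * (p - 1) < Multiset.card X) :
    ∃ A ≤ X, A ≠ 0 ∧ ∀ j, (p : ℤ) ∣ (A.map (u j)).sum := by
  have := Fact.mk hp
  obtain ⟨l, rfl⟩ := Quot.exists_rep X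
  obtain ⟨A, hA, hsum⟩ := exists_finset_sum_eq_zero_of_prime p d
    (fun (i : Fin l.length) j => (u j (l.get i) : ZMod p)) (by simpa using h)
  refine ⟨A.val.map l.get, ?_, ?_, fun j => ?_⟩
  · have huniv : (Finset.univ : Finset (Fin l.length)).val.map l.get = (l : Multiset β) := by
      rw [Fin.univ_val_map, List.ofFn_get]
    refine le_of_le_of_eq (Multiset.map_le_map (Finset.val_le_iff.mpr A.subset_univ)) huniv
  · exact fun h0 => hA.ne_empty (Finset.val_eq_zero.mp (Multiset.map_eq_zero.mp h0))
  · rw [← ZMod.intCast_zmod_eq_zero_iff_dvd, Int.cast_multiset_sum, Multiset.map_map,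
      Multiset.map_map]
    exact hsum j

/-- The family `S` of integer pairs `(f a, g a)` has sum zero modulo `n`. -/
def IsZeroSumMod {α : Type*} (f g : α → ℤ) (n : ℕ) (S : Multiset α) : Prop :=
  (n : ℤ) ∣ (S.map f).sum ∧ (n : ℤ) ∣ (S.map g).sum

section

variable {α : Type*} {f g : α → ℤ} {n m : ℕ}

lemma IsZeroSumMod.of_add {A B : Multiset α} (hAB : IsZeroSumMod f g n (A + B))
    (hA : IsZeroSumMod f g n A) : IsZeroSumMod f g n B := by
  simp only [IsZeroSumMod, Multiset.map_add, Multiset.sum_add] at hAB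
  exact ⟨(dvd_add_right hA.1).mp hAB.1, (dvd_add_right hA.2).mp hAB.2⟩

lemma IsZeroSumMod.of_dvd {A : Multiset α} (hmn : m ∣ n) (hA : IsZeroSumMod f g n A) :
    IsZeroSumMod f g m A :=
  have h := Int.natCast_dvd_natCast.mpr hmn
  ⟨h.trans hA.1, h.trans hA.2⟩

/-- A zero-sum family splits into short zero-sum blocks and one nonempty remainder, provided
that long zero-sum families contain short ones. -/
lemma exists_block_decomposition (hm : 1 ≤ m)
    (h : ∀ S : Multiset α, 2 * m ≤ Multiset.card S → IsZeroSumMod f g m S →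
      ∃ T ≤ S, T ≠ 0 ∧ Multiset.card T ≤ m ∧ IsZeroSumMod f g m T)
    (S : Multiset α) (hS : m ≤ Multiset.card S) (hZ : IsZeroSumMod f g m S) :
    ∃ (F : Multiset (Multiset α)) (R : Multiset α), F.join + R = S ∧
      (∀ B ∈ F, B ≠ 0 ∧ Multiset.card B ≤ m ∧ IsZeroSumMod f g m B) ∧
      R ≠ 0 ∧ Multiset.card R < 2 * m ∧ IsZeroSumMod f g m R := by
  induction hk : Multiset.card S using Nat.strong_induction_on generalizing S with
  | _ k ih =>
  by_cases hlt : Multiset.card S < 2 * m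
  · refine ⟨0, S, by simp, by simp, ?_, hlt, hZ⟩
    rintro rfl
    simp at hS
    omega
  · obtain ⟨T, hTS, hT0, hTm, hTZ⟩ := h S (by omega) hZ
    obtain ⟨U, rfl⟩ := Multiset.le_iff_exists_add.mp hTS
    have hTpos := Multiset.card_pos.mpr hT0
    rw [Multiset.card_add] at hk hlt
    obtain ⟨F, R, hFR, hF, hR⟩ := ih (Multiset.card U) (by omega) U (by omega)
      (hZ.of_add hTZ) rfl
    refine ⟨T ::ₘ F, R, by simp [← hFR, add_assoc], ?_, hR⟩
    simpa using ⟨⟨hT0, hTm, hTZ⟩, hF⟩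

lemma sum_map_join (f : α → ℤ) (A : Multiset (Multiset α))
    (hA : ∀ B ∈ A, (m : ℤ) ∣ (B.map f).sum) :
    (A.join.map f).sum = m * (A.map fun B => (B.map f).sum / (m : ℤ)).sum := by
  induction A using Multiset.induction_on with
  | empty => simp
  | cons B A ih =>
    rw [Multiset.forall_mem_cons] at hA
    rw [Multiset.join_cons, Multiset.map_add, Multiset.sum_add, ih hA.2, Multiset.map_cons,
      Multiset.sum_cons, mul_add, Int.mul_ediv_cancel' hA.1]

lemma isZeroSumMod_join {p : ℕ} {A : Multiset (Multiset α)}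
    (hA : ∀ B ∈ A, IsZeroSumMod f g m B)
    (hf : (p : ℤ) ∣ (A.map fun B => (B.map f).sum / (m : ℤ)).sum)
    (hg : (p : ℤ) ∣ (A.map fun B => (B.map g).sum / (m : ℤ)).sum) :
    IsZeroSumMod f g (m * p) A.join := by
  refine ⟨?_, ?_⟩
  · rw [sum_map_join f A fun B hB => (hA B hB).1, Nat.cast_mul]
    exact mul_dvd_mul_left _ hf
  · rw [sum_map_join g A fun B hB => (hA B hB).2, Nat.cast_mul]
    exact mul_dvd_mul_left _ hg

lemma join_ne_zero {A : Multiset (Multiset α)} (hA : A ≠ 0) (h : ∀ B ∈ A, B ≠ 0) :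
    A.join ≠ 0 := by
  obtain ⟨B, hB⟩ := Multiset.exists_mem_of_ne_zero hA
  obtain ⟨C, rfl⟩ := Multiset.exists_cons_of_mem hB
  simp [h B hB]

lemma join_le_join {A F : Multiset (Multiset α)} (h : A ≤ F) : A.join ≤ F.join := by
  obtain ⟨C, rfl⟩ := Multiset.le_iff_exists_add.mp h
  simp

lemma card_join_le {A : Multiset (Multiset α)} (h : ∀ B ∈ A, Multiset.card B ≤ m) :
    Multiset.card A.join ≤ m * Multiset.card A := by
  rw [Multiset.card_join, mul_comm]
  simpa using Multiset.sum_le_card_nsmul (A.map Multiset.card) m (by simpa using h)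

/-- With at least `3p - 2` blocks that are zero-sum modulo `m`, at most `p` of them
combine to a family that is zero-sum modulo `m * p`. -/
lemma exists_short_of_many_blocks {p : ℕ} (hp : p.Prime) (F : Multiset (Multiset α))
    (hF : ∀ B ∈ F, IsZeroSumMod f g m B) (hcard : 3 * (p - 1) < Multiset.card F) :
    ∃ A ≤ F, A ≠ 0 ∧ Multiset.card A ≤ p ∧ IsZeroSumMod f g (m * p) A.join := by
  classical
  have hp2 := hp.two_le
  obtain ⟨F', hF', hF'card⟩ := exists_le_card_eq
    (show 3 * (p - 1) + 1 ≤ Multiset.card F from hcard)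
  obtain ⟨A, hA, hA0, hdvd⟩ := exists_le_dvd_sum_of_prime p 3 hp F'
    ![fun B => (B.map f).sum / (m : ℤ), fun B => (B.map g).sum / (m : ℤ), fun _ => 1] (by omega)
  have hAF := hA.trans hF'
  have hA1 : IsZeroSumMod f g (m * p) A.join := isZeroSumMod_join
    (fun B hB => hF B (Multiset.mem_of_le hAF hB)) (hdvd 0) (hdvd 1)
  have hAcard : p ∣ Multiset.card A := by
    have := hdvd 2
    simpa [Int.natCast_dvd_natCast] using this
  have hAle := Multiset.card_le_card hA
  have hApos := Multiset.card_pos.mpr hA0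
  by_cases hle : Multiset.card A ≤ p
  · exact ⟨A, hAF, hA0, hle, hA1⟩
  obtain ⟨c, hc⟩ := hAcard
  have hc3 : c < 3 := by
    by_contra! h3
    have := Nat.mul_le_mul_left p h3
    omega
  have hc2 : c = 2 := by
    interval_cases c <;> omega
  subst hc2
  obtain ⟨A', hA', hA'card⟩ := exists_le_card_eq
    (show 2 * (p - 1) + 1 ≤ Multiset.card A by omega)
  obtain ⟨C, hC, hC0, hCdvd⟩ := exists_le_dvd_sum_of_prime p 2 hp A'
    ![fun B => (B.map f).sum / (m : ℤ), fun B => (B.map g).sum / (m : ℤ)] (by omega)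
  have hCA := hC.trans hA'
  have hC1 : IsZeroSumMod f g (m * p) C.join := isZeroSumMod_join
    (fun B hB => hF B (Multiset.mem_of_le (hCA.trans hAF) hB)) (hCdvd 0) (hCdvd 1)
  have hCle := Multiset.card_le_card hC
  by_cases hCp : Multiset.card C ≤ p
  · exact ⟨C, hCA.trans hAF, hC0, hCp, hC1⟩
  obtain ⟨E, rfl⟩ := Multiset.le_iff_exists_add.mp hCA
  rw [Multiset.card_add] at hc
  refine ⟨E, (Multiset.le_add_left _ _).trans hAF, ?_, by omega, ?_⟩
  · rw [← Multiset.card_pos]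
    omega
  · rw [Multiset.join_add] at hA1
    exact hA1.of_add hC1

/-- The inductive step from `m` to `m * p` when there are at most `3p - 3` short blocks: the
remainder `R` is given weight `2`, and the family is padded with empty blocks. -/
lemma exists_short_of_few_blocks {p : ℕ} (hp : p.Prime) (F : Multiset (Multiset α))
    (R : Multiset α)
    (hF : ∀ B ∈ F, B ≠ 0 ∧ Multiset.card B ≤ m ∧ IsZeroSumMod f g m B)
    (hR0 : R ≠ 0) (hRm : Multiset.card R < 2 * m) (hRZ : IsZeroSumMod f g m R)
    (hZ : IsZeroSumMod f g (m * p) (F.join + R))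
    (hlow : 2 * p ≤ Multiset.card F + 1) (hup : Multiset.card F ≤ 3 * (p - 1)) :
    ∃ T ≤ F.join + R, T ≠ 0 ∧ Multiset.card T ≤ m * p ∧ IsZeroSumMod f g (m * p) T := by
  classical
  have hp2 := hp.two_le
  set z := 3 * (p - 1) - Multiset.card F with hz
  set X : Multiset (Multiset α × ℕ) :=
    F.map (fun B => (B, 1)) + Multiset.replicate z (0, 1) + {(R, 2)} with hX
  have hXcard : Multiset.card X = 3 * (p - 1) + 1 := by
    simp [hX]
    omega
  have hXweight : (X.map Prod.snd).sum = 3 * p - 1 := by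
    simp [hX]
    omega
  have hXjoin : (X.map Prod.fst).join = F.join + R := by
    simp [hX, Multiset.map_replicate, Multiset.join, Multiset.sum_replicate]
  have hXmem : ∀ x ∈ X, Multiset.card x.1 ≤ m * x.2 ∧ IsZeroSumMod f g m x.1 := by
    intro x hx
    simp only [hX, Multiset.mem_add, Multiset.mem_map, Multiset.mem_singleton] at hx
    rcases hx with (⟨B, hB, rfl⟩ | hx) | rfl
    · exact ⟨by simpa using (hF B hB).2.1, (hF B hB).2.2⟩
    · rw [Multiset.eq_of_mem_replicate hx]
      simp [IsZeroSumMod]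
    · exact ⟨by simp only; omega, hRZ⟩
  have hXempty : ((X.filter fun x => x.1 = 0).map Prod.snd).sum = z := by
    have hFe : (F.map fun B => (B, 1)).filter (fun x : Multiset α × ℕ => x.1 = 0) = 0 := by
      rw [Multiset.filter_eq_nil]
      intro x hx
      obtain ⟨B, hB, rfl⟩ := Multiset.mem_map.mp hx
      exact (hF B hB).1
    have hRe : ({(R, 2)} : Multiset (Multiset α × ℕ)).filter (fun x => x.1 = 0) = 0 := by
      simp [Multiset.filter_singleton, hR0]
    have hze : (Multiset.replicate z ((0 : Multiset α), 1)).filter (fun x => x.1 = 0) =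
        Multiset.replicate z (0, 1) :=
      Multiset.filter_eq_self.mpr fun x hx => by rw [Multiset.eq_of_mem_replicate hx]
    simp [hX, Multiset.filter_add, hFe, hRe, hze]
  have hshort : ∀ Y ≤ X, p - 1 ≤ (Y.map Prod.snd).sum → (Y.map Prod.snd).sum ≤ p →
      (Y.map Prod.fst).join ≠ 0 ∧ Multiset.card (Y.map Prod.fst).join ≤ m * p := by
    intro Y hY hlo hhi
    refine ⟨fun h0 => ?_, ?_⟩
    · have hYe : Y.filter (fun x => x.1 = 0) = Y := by
        refine Multiset.filter_eq_self.mpr fun x hx => ?_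
        by_contra hx0
        obtain ⟨C, rfl⟩ := Multiset.exists_cons_of_mem hx
        simp [hx0] at h0
      have hle : Y ≤ X.filter fun x => x.1 = 0 := hYe ▸ Multiset.filter_le_filter _ hY
      obtain ⟨C, hC⟩ := Multiset.le_iff_exists_add.mp hle
      rw [hC, Multiset.map_add, Multiset.sum_add] at hXempty
      omega
    · have h1 : Multiset.card (Y.map Prod.fst).join ≤ m * (Y.map Prod.snd).sum := by
        rw [Multiset.card_join, Multiset.map_map, ← Multiset.sum_map_mul_left]
        exact Multiset.sum_map_le_sum_map _ _ fun x hx => (hXmem x (Multiset.mem_of_le hY hx)).1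
      exact h1.trans (Nat.mul_le_mul_left m hhi)
  obtain ⟨A, hA, hA0, hdvd⟩ := exists_le_dvd_sum_of_prime p 3 hp X
    ![fun x => (x.1.map f).sum / (m : ℤ), fun x => (x.1.map g).sum / (m : ℤ),
      fun x => (x.2 : ℤ)] (by omega)
  have hA1 : IsZeroSumMod f g (m * p) (A.map Prod.fst).join := by
    refine isZeroSumMod_join ?_ ?_ ?_
    · intro B hB
      obtain ⟨x, hx, rfl⟩ := Multiset.mem_map.mp hB
      exact (hXmem x (Multiset.mem_of_le hA hx)).2
    · rw [Multiset.map_map]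
      exact hdvd 0
    · rw [Multiset.map_map]
      exact hdvd 1
  have hAw : p ∣ (A.map Prod.snd).sum := by
    have h2 : (p : ℤ) ∣ (A.map fun x => (x.2 : ℤ)).sum := hdvd 2
    have hcast : (A.map fun x => (x.2 : ℤ)).sum = ((A.map Prod.snd).sum : ℕ) := by
      rw [Nat.cast_multiset_sum, Multiset.map_map]
      rfl
    rwa [hcast, Int.natCast_dvd_natCast] at h2
  have hApos : 0 < (A.map Prod.snd).sum := by
    obtain ⟨x, hx⟩ := Multiset.exists_mem_of_ne_zero hA0
    have hx1 : 1 ≤ x.2 := by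
      have hxX := Multiset.mem_of_le hA hx
      simp only [hX, Multiset.mem_add, Multiset.mem_map, Multiset.mem_singleton] at hxX
      rcases hxX with (⟨B, hB, rfl⟩ | hx) | rfl
      · exact le_rfl
      · rw [Multiset.eq_of_mem_replicate hx]
      · exact one_le_two
    exact lt_of_lt_of_le hx1
      (Multiset.single_le_sum (by simp) _ (Multiset.mem_map_of_mem _ hx))
  obtain ⟨E, hE⟩ := Multiset.le_iff_exists_add.mp hA
  have hsplit : (A.map Prod.fst).join + (E.map Prod.fst).join = F.join + R := by
    rw [← hXjoin, hE, Multiset.map_add, Multiset.join_add]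
  have hweights : (A.map Prod.snd).sum + (E.map Prod.snd).sum = 3 * p - 1 := by
    rw [← hXweight, hE, Multiset.map_add, Multiset.sum_add]
  obtain ⟨c, hc⟩ := hAw
  have hc3 : c < 3 := by
    by_contra! h3
    have := Nat.mul_le_mul_left p h3
    omega
  have hc12 : c = 1 ∨ c = 2 := by
    interval_cases c <;> omega
  rcases hc12 with rfl | rfl
  · obtain ⟨h0, hle⟩ := hshort A hA (by omega) (by omega)
    exact ⟨_, hsplit ▸ Multiset.le_add_right _ _, h0, hle, hA1⟩
  · obtain ⟨h0, hle⟩ := hshort E (hE ▸ Multiset.le_add_left _ _) (by omega) (by omega)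
    exact ⟨_, hsplit ▸ Multiset.le_add_left _ _, h0, hle, (hsplit ▸ hZ).of_add hA1⟩

/-- A zero-sum sequence of length at least `2n` over `C_n ⊕ C_n` contains a nonempty
zero-sum subsequence of length at most `n`. -/
lemma exists_short_mod (hn : 1 ≤ n) (S : Multiset α)
    (hS : 2 * n ≤ Multiset.card S) (hZ : IsZeroSumMod f g n S) :
    ∃ T ≤ S, T ≠ 0 ∧ Multiset.card T ≤ n ∧ IsZeroSumMod f g n T := by
  induction n using induction_on_primes generalizing S with
  | zero => omega
  | one =>
    obtain ⟨T, hT, hTcard⟩ := exists_le_card_eq (show 1 ≤ Multiset.card S by omega)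
    exact ⟨T, hT, Multiset.card_pos.mp (by omega), hTcard.le, by simp [IsZeroSumMod]⟩
  | prime_mul p m hp ih =>
    have hm : 1 ≤ m := Nat.pos_of_mul_pos_left hn
    have hp2 := hp.two_le
    rw [mul_comm p m] at *
    obtain ⟨F, R, rfl, hF, hR0, hRm, hRZ⟩ := exists_block_decomposition hm (ih hm) S
      (by nlinarith) (hZ.of_dvd (dvd_mul_right m p))
    have hcard := card_join_le fun B hB => (hF B hB).2.1
    rw [Multiset.card_add] at hS
    have hlow : 2 * p ≤ Multiset.card F + 1 := by
      by_contra! hlt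
      have := Nat.mul_le_mul_left m (show Multiset.card F + 2 ≤ 2 * p by omega)
      nlinarith
    by_cases hup : Multiset.card F ≤ 3 * (p - 1)
    · exact exists_short_of_few_blocks hp F R hF hR0 hRm hRZ hZ hlow hup
    · obtain ⟨A, hA, hA0, hAp, hAZ⟩ := exists_short_of_many_blocks hp F
        (fun B hB => (hF B hB).2.2) (not_le.mp hup)
      refine ⟨A.join, (join_le_join hA).trans (Multiset.le_add_right _ _),
        join_ne_zero hA0 fun B hB => (hF B (Multiset.mem_of_le hA hB)).1, ?_, hAZ⟩
      exact (card_join_le fun B hB => (hF B (Multiset.mem_of_le hA hB)).2.1).trans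
        (Nat.mul_le_mul_left m hAp)

/-- A zero-sum sequence of length at least `n + n * r` over `C_n ⊕ C_{n * r}` contains a
nonempty zero-sum subsequence of length at most `n * r`. -/
lemma exists_short_mod_mul {r : ℕ} (hn : 1 ≤ n) (hr : 1 ≤ r) (S : Multiset α)
    (hS : n + n * r ≤ Multiset.card S) (hf : (n : ℤ) ∣ (S.map f).sum)
    (hg : ((n * r : ℕ) : ℤ) ∣ (S.map g).sum) :
    ∃ T ≤ S, T ≠ 0 ∧ Multiset.card T ≤ n * r ∧ (n : ℤ) ∣ (T.map f).sum ∧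
      ((n * r : ℕ) : ℤ) ∣ (T.map g).sum := by
  obtain ⟨F, R, rfl, hF, hR0, hRm, hRZ⟩ := exists_block_decomposition hn (exists_short_mod hn) S
    (by nlinarith) ⟨hf, (Int.natCast_dvd_natCast.mpr (dvd_mul_right n r)).trans hg⟩
  have hcard := card_join_le fun B hB => (hF B hB).2.1
  rw [Multiset.card_add] at hS
  have hlow : r ≤ Multiset.card F := by
    by_contra! hlt
    have := Nat.mul_le_mul_left n (show Multiset.card F + 1 ≤ r from hlt)
    nlinarith
  obtain ⟨F', hF', hF'card⟩ := exists_le_card_eq hlow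
  have : NeZero r := ⟨by omega⟩
  obtain ⟨A, hA, hA0, hAr⟩ := exists_le_sum_map_eq_zero F'
    (fun B => (((B.map g).sum / (n : ℤ) : ℤ) : ZMod r)) (by simp [hF'card])
  have hAF := hA.trans hF'
  have hAB : ∀ B ∈ A, B ≠ 0 ∧ Multiset.card B ≤ n ∧ IsZeroSumMod f g n B :=
    fun B hB => hF B (Multiset.mem_of_le hAF hB)
  refine ⟨A.join, (join_le_join hAF).trans (Multiset.le_add_right _ _),
    join_ne_zero hA0 fun B hB => (hAB B hB).1, ?_, ?_, ?_⟩
  · exact (card_join_le fun B hB => (hAB B hB).2.1).trans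
      (Nat.mul_le_mul_left n ((Multiset.card_le_card hA).trans hF'card.le))
  · rw [sum_map_join f A fun B hB => (hAB B hB).2.2.1]
    exact dvd_mul_right _ _
  · rw [sum_map_join g A fun B hB => (hAB B hB).2.2.2, Nat.cast_mul]
    refine mul_dvd_mul_left _ ((ZMod.intCast_zmod_eq_zero_iff_dvd _ _).mp ?_)
    rw [Int.cast_multiset_sum, Multiset.map_map]
    exact hAr

end

/-- The lower bound `n1 + n2 - 1 ≤ D(C_{n1} ⊕ C_{n2})`. -/
lemma add_le_davenport_add_one {G : Type*} [AddCommGroup G] {n1 n2 : ℕ} (hn1 : 1 < n1)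
    (hn2 : 0 < n2) (e : G ≃+ ZMod n1 × ZMod n2) : n1 + n2 ≤ davenport G + 1 := by
  classical
  have : NeZero n1 := ⟨by omega⟩
  have : NeZero n2 := ⟨by omega⟩
  have : Finite G := Finite.of_equiv _ e.symm.toEquiv
  have : Fact (1 < n1) := ⟨hn1⟩
  have hne : {d : ℕ | ∀ S : Multiset G, d ≤ Multiset.card S →
      ∃ T, T ≤ S ∧ T ≠ 0 ∧ T.sum = 0}.Nonempty :=
    ⟨Nat.card G, fun S hS => by simpa using exists_le_sum_map_eq_zero S id hS⟩
  have hD := Nat.sInf_mem hne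
  by_contra! hlt
  set x := e.symm (1, 0) with hx
  set y := e.symm (0, 1) with hy
  have hxy : y ≠ x := by
    rw [hx, hy, ne_eq, e.symm.injective.eq_iff, Prod.mk.injEq]
    exact fun h => zero_ne_one h.1
  obtain ⟨T, hT, hT0, hsum⟩ := hD
    (Multiset.replicate (n1 - 1) x + Multiset.replicate (n2 - 1) y) (by
      change davenport G ≤ _
      simp
      omega)
  have hTx := Multiset.count_le_of_le x hT
  have hTy := Multiset.filter_le_filter (fun z => ¬ z = x) hT
  have h1 : (Multiset.replicate (n1 - 1) x).filter (fun z => ¬ z = x) = 0 :=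
    Multiset.filter_eq_nil.mpr fun z hz => by simp [Multiset.eq_of_mem_replicate hz]
  have h2 : (Multiset.replicate (n2 - 1) y).filter (fun z => ¬ z = x) =
      Multiset.replicate (n2 - 1) y :=
    Multiset.filter_eq_self.mpr fun z hz => by simpa [Multiset.eq_of_mem_replicate hz] using hxy
  rw [Multiset.filter_add, h1, h2, zero_add, Multiset.le_replicate_iff] at hTy
  obtain ⟨b, hb, hTb⟩ := hTy
  have hTsplit := Multiset.filter_add_not (fun z => z = x) T
  rw [hTb, Multiset.filter_eq' T x] at hTsplit
  set a := Multiset.count x T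
  have ha : a ≤ n1 - 1 := by
    simpa [Multiset.count_replicate, hxy] using hTx
  rw [← hTsplit] at hsum hT0
  have hesum := congrArg e hsum
  simp only [Multiset.sum_add, Multiset.sum_replicate, map_add, map_nsmul, hx, hy,
    AddEquiv.apply_symm_apply, map_zero, Prod.smul_mk, Prod.mk_add_mk, Prod.mk_eq_zero,
    smul_zero, add_zero, zero_add, nsmul_eq_mul, mul_one] at hesum
  rw [ZMod.natCast_eq_zero_iff, ZMod.natCast_eq_zero_iff] at hesum
  have ha0 := Nat.eq_zero_of_dvd_of_lt hesum.1 (by omega)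
  have hb0 := Nat.eq_zero_of_dvd_of_lt hesum.2 (by omega)
  simp [ha0, hb0] at hT0

lemma hasShortZeroSumSubseq_of_add_le_card {G : Type*} [AddCommGroup G] {n1 n2 : ℕ}
    (hn1 : 0 < n1) (hdvd : n1 ∣ n2) (hn2 : 0 < n2) (e : G ≃+ ZMod n1 × ZMod n2)
    (S : Multiset G) (hS : n1 + n2 ≤ Multiset.card S) (hsum : S.sum = 0) :
    HasShortZeroSumSubseq S := by
  obtain ⟨r, rfl⟩ := hdvd
  have hexp : AddMonoid.exponent G = n1 * r := by
    rw [AddMonoid.exponent_eq_of_addEquiv e, AddMonoid.exponent_prod, ZMod.exponent,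
      ZMod.exponent]
    exact Nat.lcm_eq_right (dvd_mul_right n1 r)
  let f : G → ℤ := fun x => (e x).1.cast
  let g : G → ℤ := fun x => (e x).2.cast
  have hf : ∀ T : Multiset G, (((T.map f).sum : ℤ) : ZMod n1) = (e T.sum).1 := fun T => by
    have h := map_multiset_sum ((AddMonoidHom.fst (ZMod n1) (ZMod (n1 * r))).comp e) T
    rw [Int.cast_multiset_sum, Multiset.map_map]
    simpa [f, Function.comp_def] using h.symm
  have hg : ∀ T : Multiset G, (((T.map g).sum : ℤ) : ZMod (n1 * r)) = (e T.sum).2 := fun T => by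
    have h := map_multiset_sum ((AddMonoidHom.snd (ZMod n1) (ZMod (n1 * r))).comp e) T
    rw [Int.cast_multiset_sum, Multiset.map_map]
    simpa [g, Function.comp_def] using h.symm
  have hzero : ∀ T : Multiset G, T.sum = 0 ↔
      (n1 : ℤ) ∣ (T.map f).sum ∧ ((n1 * r : ℕ) : ℤ) ∣ (T.map g).sum := fun T => by
    rw [← ZMod.intCast_zmod_eq_zero_iff_dvd, ← ZMod.intCast_zmod_eq_zero_iff_dvd, hf, hg,
      ← Prod.mk_eq_zero, Prod.mk.eta, EmbeddingLike.map_eq_zero_iff]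
  obtain ⟨hSf, hSg⟩ := (hzero S).mp hsum
  obtain ⟨T, hT, hT0, hTcard, hTsum⟩ := exists_short_mod_mul hn1 (Nat.pos_of_mul_pos_left hn2)
    S hS hSf hSg
  exact ⟨T, hT, (hzero T).mpr hTsum, Multiset.card_pos.mpr hT0, hexp ▸ hTcard⟩

theorem stmt_7 (G : Type*) [AddCommGroup G] (n1 n2 : ℕ) (hn1 : 1 < n1)
    (hdvd : n1 ∣ n2) (hn2 : 0 < n2) (e : G ≃+ ZMod n1 × ZMod n2) :
    C0 G = Set.Icc (davenport G + 1) (etaConst G - 1) := by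
  ext t
  refine ⟨fun h => ⟨h.1, h.2.1⟩, fun h => ⟨h.1, h.2, fun S hS hsum => ?_⟩⟩
  exact hasShortZeroSumSubseq_of_add_le_card (by omega) hdvd hn2 e S
    ((add_le_davenport_add_one hn1 hn2 e).trans (h.1.trans_eq hS.symm)) hsum
end

section
/- Let p be a prime, let H be a nontrivial finite abelian p-group, let n, m be positive integers with p^n ≥ D(H), and let G = C_{p^n m} ⊕ H. Then C_0(G) equals the full interval [D(G)+1, η(G)-1]. -/
open Finset

namespace ZeroSum

section Nilpotent

variable {R : Type*} [CommRing R]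

theorem sup_pow_eq_bot {I J : Ideal R} {a b : ℕ} (hI : I ^ (a + 1) = ⊥) (hJ : J ^ (b + 1) = ⊥) :
    (I ⊔ J) ^ (a + b + 1) = ⊥ := by
  rw [← Ideal.add_eq_sup, add_pow, Ideal.sum_eq_sup, eq_bot_iff]
  refine Finset.sup_le fun i hi => ?_
  by_cases h : a + 1 ≤ i
  · exact Ideal.mul_le_left.trans (Ideal.mul_le_left.trans
      ((Ideal.pow_le_pow_right h).trans hI.le))
  · exact Ideal.mul_le_left.trans (Ideal.mul_le_right.trans
      ((Ideal.pow_le_pow_right (by lia)).trans hJ.le))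

theorem finset_sup_pow_eq_bot {ι : Type*} (s : Finset ι) (I : ι → Ideal R) (a : ι → ℕ)
    (h : ∀ i ∈ s, I i ^ (a i + 1) = ⊥) : (s.sup I) ^ (∑ i ∈ s, a i + 1) = ⊥ := by
  classical
  induction s using Finset.induction_on with
  | empty => simp
  | insert i s hi ih =>
    rw [Finset.sup_insert, Finset.sum_insert hi]
    exact sup_pow_eq_bot (h i (by simp)) (ih fun j hj => h j (by simp [hj]))

end Nilpotent

section GroupRing

variable {p : ℕ} [Fact p.Prime] {G : Type*} [AddCommGroup G]

theorem one_sub_single_mem_of_mem_closure {s : Set G} (J : Ideal (AddMonoidAlgebra (ZMod p) G))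
    (hJ : ∀ g ∈ s, 1 - AddMonoidAlgebra.single g 1 ∈ J) {g : G}
    (hg : g ∈ AddSubgroup.closure s) : 1 - AddMonoidAlgebra.single g 1 ∈ J := by
  induction hg using AddSubgroup.closure_induction with
  | mem g hg => exact hJ g hg
  | zero => simp [AddMonoidAlgebra.one_def]
  | add x y _ _ hx hy =>
    have : (1 - AddMonoidAlgebra.single (x + y) 1 : AddMonoidAlgebra (ZMod p) G) =
        (1 - AddMonoidAlgebra.single x 1) +
          AddMonoidAlgebra.single x 1 * (1 - AddMonoidAlgebra.single y 1) := by
      rw [mul_sub, AddMonoidAlgebra.single_mul_single]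
      simp
    rw [this]
    exact J.add_mem hx (J.mul_mem_left _ hy)
  | neg x _ hx =>
    have : (1 - AddMonoidAlgebra.single (-x) 1 : AddMonoidAlgebra (ZMod p) G) =
        -(AddMonoidAlgebra.single (-x) 1 * (1 - AddMonoidAlgebra.single x 1)) := by
      rw [mul_sub, AddMonoidAlgebra.single_mul_single]
      simp [AddMonoidAlgebra.one_def]
    rw [this]
    exact J.neg_mem (J.mul_mem_left _ hx)

/-- **Theorem of Olson** on products in the group ring of a finite abelian `p`-group. -/
theorem prod_one_sub_single_eq_zero {ι β : Type*} [Fintype ι] (e : ι → G) (k : ι → ℕ)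
    (he : ∀ i, p ^ k i • e i = 0) (s : Finset β) (g : β → G)
    (hg : ∀ b ∈ s, g b ∈ AddSubgroup.closure (Set.range e))
    (hs : ∑ i, (p ^ k i - 1) + 1 ≤ #s) :
    ∏ b ∈ s, (1 - AddMonoidAlgebra.single (g b) 1 : AddMonoidAlgebra (ZMod p) G) = 0 := by
  set I : ι → Ideal (AddMonoidAlgebra (ZMod p) G) :=
    fun i => Ideal.span {1 - AddMonoidAlgebra.single (e i) 1} with hI
  have hp : p.Prime := Fact.out
  have : CharP (AddMonoidAlgebra (ZMod p) G) p := charP_of_injective_algebraMap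
    (algebraMap (ZMod p) _).injective p
  have hnil : (univ.sup I) ^ (∑ i, (p ^ k i - 1) + 1) = ⊥ := by
    refine finset_sup_pow_eq_bot _ _ _ fun i _ => ?_
    have := pow_pos hp.pos (k i)
    rw [Nat.sub_add_cancel this, hI, Ideal.span_singleton_pow, sub_pow_char_pow,
      AddMonoidAlgebra.single_pow, he]
    simp [AddMonoidAlgebra.one_def]
  have hmem : ∏ b ∈ s, (1 - AddMonoidAlgebra.single (g b) 1 : AddMonoidAlgebra (ZMod p) G) ∈
      ∏ b ∈ s, univ.sup I := by
    refine Ideal.prod_mem_prod fun b hb => ?_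
    refine one_sub_single_mem_of_mem_closure _ ?_ (hg b hb)
    rintro _ ⟨i, rfl⟩
    exact Finset.le_sup (f := I) (mem_univ i) (Ideal.subset_span rfl)
  rw [prod_const] at hmem
  simpa [hnil] using Ideal.pow_le_pow_right hs hmem

/-- If `∏ (1 - X ^ g b)` vanishes in the group ring, then for every `c` the subfamilies of sum `c`
and even length are, modulo `p`, as many as those of odd length. -/
theorem sum_neg_one_pow_card_eq_zero {β : Type*} [DecidableEq G] (s : Finset β) (g : β → G)
    (h : ∏ b ∈ s, (1 - AddMonoidAlgebra.single (g b) 1 : AddMonoidAlgebra (ZMod p) G) = 0)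
    (c : G) : ∑ T ∈ s.powerset with ∑ b ∈ T, g b = c, (-1 : ZMod p) ^ #T = 0 := by
  classical
  have key (T : Finset β) : ∏ b ∈ T, (AddMonoidAlgebra.single (g b) 1 :
      AddMonoidAlgebra (ZMod p) G) = AddMonoidAlgebra.single (∑ b ∈ T, g b) 1 := by
    induction T using Finset.induction_on with
    | empty => simp [AddMonoidAlgebra.one_def]
    | insert b T hb ih => simp [prod_insert hb, sum_insert hb, ih,
        AddMonoidAlgebra.single_mul_single]
  have key' (T : Finset β) : ((-1) ^ #T * AddMonoidAlgebra.single (∑ b ∈ T, g b) 1 :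
      AddMonoidAlgebra (ZMod p) G) = AddMonoidAlgebra.single (∑ b ∈ T, g b) ((-1) ^ #T) := by
    rcases neg_one_pow_eq_or (AddMonoidAlgebra (ZMod p) G) #T with h | h <;>
      rcases Nat.even_or_odd #T with h' | h' <;> simp [h'.neg_one_pow]
  rw [prod_sub] at h
  simp only [prod_const_one, mul_one, key, key'] at h
  have h2 := DFunLike.congr_fun (congrArg AddMonoidAlgebra.coeff h) c
  rw [AddMonoidAlgebra.coeff_sum, Finsupp.finsetSum_apply] at h2
  simpa [sum_filter, Finsupp.single_apply] using h2

end GroupRing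

section Weighted

variable {R G β : Type*} [CommRing R] [AddCommGroup G] [DecidableEq G] {s : Finset β}
  {g : β → G} {d : ℕ}

theorem sum_neg_one_pow_mul_choose_eq_zero
    (h : ∀ s' ⊆ s, d ≤ #s' → ∀ c,
      ∑ T ∈ s'.powerset with ∑ b ∈ T, g b = c, (-1 : R) ^ #T = 0)
    {j : ℕ} (hj : d + j ≤ #s) (c : G) :
    ∑ T ∈ s.powerset with ∑ b ∈ T, g b = c, (-1 : R) ^ #T * ((#T).choose j : R) = 0 := by
  classical
  have hchoose : ∀ T ∈ s.powerset.filter (fun T => ∑ b ∈ T, g b = c),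
      (-1 : R) ^ #T * ((#T).choose j : R) =
        ∑ U ∈ s.powersetCard j, if U ⊆ T then (-1 : R) ^ #T else 0 := by
    intro T hT
    rw [mem_filter, mem_powerset] at hT
    have : (s.powersetCard j).filter (· ⊆ T) = T.powersetCard j := by
      ext U
      simp only [mem_filter, mem_powersetCard]
      exact ⟨fun h => ⟨h.2, h.1.2⟩, fun h => ⟨⟨h.1.trans hT.1, h.2⟩, h.1⟩⟩
    rw [← sum_filter, this, sum_const, card_powersetCard, nsmul_eq_mul, mul_comm]
  rw [sum_congr rfl hchoose, sum_comm]
  refine sum_eq_zero fun U hU => ?_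
  rw [mem_powersetCard] at hU
  have hz := h (s \ U) sdiff_subset (by rw [card_sdiff_of_subset hU.1]; lia) (c - ∑ b ∈ U, g b)
  rw [← sum_filter, ← mul_zero ((-1 : R) ^ j), ← hz, mul_sum]
  refine sum_nbij' (· \ U) (· ∪ U) ?_ ?_ ?_ ?_ ?_
  · intro T hT
    simp only [mem_filter, mem_powerset] at hT ⊢
    refine ⟨sdiff_subset_sdiff hT.1.1 le_rfl, ?_⟩
    rw [← hT.1.2, ← sum_sdiff hT.2, add_sub_cancel_right]
  · intro T hT
    simp only [mem_filter, mem_powerset] at hT ⊢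
    have hdis : Disjoint T U := disjoint_of_subset_left hT.1 sdiff_disjoint
    refine ⟨⟨union_subset (hT.1.trans sdiff_subset) hU.1, ?_⟩, subset_union_right⟩
    rw [sum_union hdis, hT.2, sub_add_cancel]
  · intro T hT
    simp only [mem_filter] at hT
    exact sdiff_union_of_subset hT.2
  · intro T hT
    simp only [mem_filter, mem_powerset] at hT
    exact union_sdiff_cancel_right (disjoint_of_subset_left hT.1 sdiff_disjoint)
  · intro T hT
    simp only [mem_filter] at hT
    rw [← pow_add, card_sdiff_of_subset hT.2, ← hU.2, Nat.add_sub_cancel' (card_le_card hT.2)]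

theorem sum_neg_one_pow_mul_choose_add_eq_zero
    (h : ∀ s' ⊆ s, d ≤ #s' → ∀ c,
      ∑ T ∈ s'.powerset with ∑ b ∈ T, g b = c, (-1 : R) ^ #T = 0)
    {k : ℕ} (hk : d + k ≤ #s) (a : ℕ) (c : G) :
    ∑ T ∈ s.powerset with ∑ b ∈ T, g b = c, (-1 : R) ^ #T * ((#T + a).choose k : R) = 0 := by
  simp only [Nat.add_choose_eq, Nat.cast_sum, Nat.cast_mul, mul_sum]
  rw [sum_comm]
  refine sum_eq_zero fun x hx => ?_
  rw [HasAntidiagonal.mem_antidiagonal] at hx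
  simp only [← mul_assoc]
  rw [← sum_mul, sum_neg_one_pow_mul_choose_eq_zero h (by lia), zero_mul]

/-- A subset of given sum with nonzero weight is accompanied by a second one. -/
theorem exists_ne_of_choose_ne_zero
    (h : ∀ s' ⊆ s, d ≤ #s' → ∀ c,
      ∑ T ∈ s'.powerset with ∑ b ∈ T, g b = c, (-1 : R) ^ #T = 0)
    {k : ℕ} (hk : d + k ≤ #s) (a : ℕ) {U : Finset β} (hU : U ⊆ s)
    (hUa : ((#U + a).choose k : R) ≠ 0) :
    ∃ T ⊆ s, T ≠ U ∧ ∑ b ∈ T, g b = ∑ b ∈ U, g b ∧ ((#T + a).choose k : R) ≠ 0 := by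
  by_contra! hcon
  have hsum := sum_neg_one_pow_mul_choose_add_eq_zero h hk a (∑ b ∈ U, g b)
  rw [sum_eq_single_of_mem U (by simp [hU])] at hsum
  · exact hUa (by simpa using hsum)
  · intro T hT hTU
    simp only [mem_filter, mem_powerset] at hT
    rw [hcon T hT.1 hTU hT.2, mul_zero]

end Weighted

section Choose

variable {p : ℕ} [hp : Fact p.Prime]

theorem choose_add_prime_pow (n x : ℕ) {k : ℕ} (hk : k < p ^ n) :
    (((x + p ^ n).choose k : ℕ) : ZMod p) = (x.choose k : ZMod p) := by
  rw [Nat.add_choose_eq, Nat.cast_sum, sum_eq_single_of_mem (k, 0) (by simp)]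
  · simp
  · rintro ⟨i, j⟩ hij hne
    simp only [HasAntidiagonal.mem_antidiagonal] at hij
    have : (((p ^ n).choose j : ℕ) : ZMod p) = 0 := by
      rw [ZMod.natCast_eq_zero_iff]
      refine hp.out.dvd_choose_pow ?_ (by lia)
      rintro rfl
      simp_all
    simp [this]

theorem choose_add_mul_prime_pow (n x a : ℕ) {k : ℕ} (hk : k < p ^ n) :
    (((x + a * p ^ n).choose k : ℕ) : ZMod p) = (x.choose k : ZMod p) := by
  induction a with
  | zero => simp
  | succ a ih => rw [add_mul, one_mul, ← add_assoc, choose_add_prime_pow n _ hk, ih]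

end Choose

section Core

variable {p : ℕ} [hp : Fact p.Prime] {G β : Type*} [AddCommGroup G] [DecidableEq G]
  {s : Finset β} {g : β → G} {n : ℕ}

theorem exists_short_of_three_mul_le
    (h : ∀ s' ⊆ s, 2 * p ^ n - 1 ≤ #s' → ∀ c,
      ∑ T ∈ s'.powerset with ∑ b ∈ T, g b = c, (-1 : ZMod p) ^ #T = 0)
    (hs : #s = 3 * p ^ n - 1) :
    ∃ T ⊆ s, T.Nonempty ∧ #T ≤ p ^ n ∧ ∑ b ∈ T, g b = 0 := by
  classical
  have hq : 0 < p ^ n := pow_pos hp.out.pos n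
  obtain ⟨T, hTs, hT, hsum, hne⟩ := exists_ne_of_choose_ne_zero (k := p ^ n - 1) h (by lia)
    (p ^ n - 1) (empty_subset s) (by simp)
  rw [sum_empty] at hsum
  rw [← nonempty_iff_ne_empty] at hT
  have hcard := card_le_card hTs
  have hpos := hT.card_pos
  by_cases hle : #T ≤ p ^ n
  · exact ⟨T, hTs, hT, hle, hsum⟩
  have hTcard : #T = 2 * p ^ n := by
    by_contra h2
    refine hne ?_
    obtain ⟨a, i, hi, hai⟩ : ∃ a i, i < p ^ n - 1 ∧ #T + (p ^ n - 1) = i + a * p ^ n := by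
      by_cases h3 : #T < 2 * p ^ n
      · exact ⟨2, #T - p ^ n - 1, by lia, by lia⟩
      · exact ⟨3, #T - 2 * p ^ n - 1, by lia, by lia⟩
    rw [hai, choose_add_mul_prime_pow n _ _ (by lia), Nat.choose_eq_zero_of_lt hi, Nat.cast_zero]
  obtain ⟨x, hx⟩ := hT
  have hsub : T.erase x ⊆ T := erase_subset _ _
  obtain ⟨U, hUT, hU, hUsum, -⟩ := exists_ne_of_choose_ne_zero (s := T.erase x) (k := 0)
    (fun s' hs' => h s' (hs'.trans (hsub.trans hTs)))
    (by rw [card_erase_of_mem hx]; lia) 0 (empty_subset _) (by simp)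
  rw [sum_empty] at hUsum
  rw [← nonempty_iff_ne_empty] at hU
  by_cases hUle : #U ≤ p ^ n
  · exact ⟨U, hUT.trans (hsub.trans hTs), hU, hUle, hUsum⟩
  have hdiff := card_sdiff_of_subset (hUT.trans hsub)
  refine ⟨T \ U, sdiff_subset.trans hTs, ⟨x, ?_⟩, by lia, ?_⟩
  · exact mem_sdiff.2 ⟨hx, fun hxU => notMem_erase x T (hUT hxU)⟩
  · have := sum_sdiff (f := g) (hUT.trans hsub)
    rwa [hUsum, add_zero, hsum] at this

theorem exists_short_or_of_sum_add_eq_zero {r : ℕ}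
    (h : ∀ s' ⊆ s, 2 * p ^ n - 1 ≤ #s' → ∀ c,
      ∑ T ∈ s'.powerset with ∑ b ∈ T, g b = c, (-1 : ZMod p) ^ #T = 0)
    (hr : r < p ^ n) (hs : #s + 1 = 2 * p ^ n + r) {c : G} (hc : ∑ b ∈ s, g b + c = 0) :
    (∃ T ⊆ s, T.Nonempty ∧ #T ≤ p ^ n ∧ ∑ b ∈ T, g b = 0) ∨
      ∃ T ⊆ s, #T + 2 ≤ p ^ n ∧ ∑ b ∈ T, g b + c = 0 := by
  classical
  obtain ⟨T, hTs, hT, hsum, hne⟩ := exists_ne_of_choose_ne_zero (k := r) h (by lia) 1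
    (Subset.refl s) (by
      rw [hs, add_comm, choose_add_mul_prime_pow n _ _ hr]; simp)
  have hlt := card_lt_card (hTs.ssubset_of_ne hT)
  have hdiff := card_sdiff_of_subset hTs
  by_cases hle : #T + 2 ≤ p ^ n
  · exact Or.inr ⟨T, hTs, hle, by rw [hsum, hc]⟩
  by_cases hge : p ^ n + r ≤ #T + 1
  · refine Or.inl ⟨s \ T, sdiff_subset, card_pos.1 (by lia), by lia, ?_⟩
    have := sum_sdiff (f := g) hTs
    rwa [hsum, add_eq_right] at this
  · refine absurd ?_ hne
    have : #T + 1 = (#T + 1 - p ^ n) + 1 * p ^ n := by lia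
    rw [this, choose_add_mul_prime_pow n _ _ hr, Nat.choose_eq_zero_of_lt (by lia), Nat.cast_zero]

end Core

section Blocks

theorem exists_disjoint_blocks {β : Type*} {m : ℕ} (hm : 0 < m) (s : Finset β) (a : β → ZMod m)
    (l : ℕ) (hl : l * m + m - 1 ≤ #s) :
    ∃ B : ℕ → Finset β, (∀ i ∈ range l, B i ⊆ s ∧ #(B i) = m ∧ ∑ b ∈ B i, a b = 0) ∧
      Set.PairwiseDisjoint (range l : Set ℕ) B := by
  classical
  induction l with
  | zero => exact ⟨fun _ => ∅, by simp, by simp⟩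
  | succ l ih =>
    obtain ⟨B, hB, hdis⟩ := ih (by lia)
    have hcard : #((range l).biUnion B) = l * m := by
      rw [card_biUnion hdis, sum_congr rfl fun i hi => (hB i hi).2.1]
      simp
    have hsub : (range l).biUnion B ⊆ s := biUnion_subset.2 fun i hi => (hB i hi).1
    obtain ⟨t, ht, htm, hta⟩ := ZMod.erdos_ginzburg_ziv (s := s \ (range l).biUnion B) a
      (by rw [card_sdiff_of_subset hsub, hcard]; lia)
    refine ⟨Function.update B l t, ?_, ?_⟩
    · intro i hi
      rcases eq_or_ne i l with rfl | hil
      · simpa using ⟨ht.trans sdiff_subset, htm, hta⟩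
      · simpa [hil] using hB i (by grind)
    · have hdt : ∀ i ∈ range l, Disjoint (B i) t := fun i hi =>
        disjoint_of_subset_left (subset_biUnion_of_mem B hi)
          (disjoint_of_subset_right ht disjoint_sdiff)
      intro i hi j hj hij
      simp only [coe_range, Set.mem_Iio] at hi hj
      rcases eq_or_ne i l with rfl | hil
      · simpa [Function.onFun, hij.symm] using (hdt j (by grind)).symm
      · rcases eq_or_ne j l with rfl | hjl
        · simpa [Function.onFun, hij] using hdt i (by grind)
        · simpa [Function.onFun, hil, hjl] using hdis (by grind) (by grind) hij

end Blocks

section Davenport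

variable {G : Type*} [AddCommGroup G]

theorem davenport_mem [Finite G] (S : Multiset G) (hS : davenport G ≤ Multiset.card S) :
    ∃ T, T ≤ S ∧ T ≠ 0 ∧ T.sum = 0 := by
  classical
  cases nonempty_fintype G
  have hne : {d : ℕ | ∀ S : Multiset G, d ≤ Multiset.card S →
      ∃ T, T ≤ S ∧ T ≠ 0 ∧ T.sum = 0}.Nonempty := by
    refine ⟨Fintype.card G * Fintype.card G + 1, fun S hS => ?_⟩
    obtain ⟨a, ha⟩ : ∃ a, Fintype.card G ≤ S.count a := by
      by_contra! hcon
      have := Multiset.sum_count_eq_card (s := univ) (m := S) (by simp)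
      have h2 := sum_le_card_nsmul univ (fun a => S.count a) _ fun a _ => (hcon a).le
      simp only [card_univ, smul_eq_mul] at h2
      lia
    refine ⟨Multiset.replicate (Fintype.card G) a, Multiset.le_count_iff_replicate_le.1 ha, ?_, ?_⟩
    · rw [← Multiset.card_pos]
      simp [Fintype.card_pos]
    · simp
  exact Nat.sInf_mem hne S hS

theorem exists_basis_sum_lt_davenport {p : ℕ} (hp : p.Prime) [Finite G] {N : ℕ}
    (hG : Nat.card G = p ^ N) :
    ∃ (ι : Type) (_ : Fintype ι) (e : ι → G) (k : ι → ℕ), (∀ i, p ^ k i • e i = 0) ∧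
      AddSubgroup.closure (Set.range e) = ⊤ ∧ ∑ i, (p ^ k i - 1) < davenport G := by
  classical
  obtain ⟨ι, _, P, hP, k, ⟨f₀⟩⟩ := AddCommGroup.equiv_directSum_zmod_of_finite G
  let f : G ≃+ ((i : ι) → ZMod (P i ^ k i)) := f₀.trans (DirectSum.addEquivProd _)
  have hpk : ∀ i, P i ^ k i = p ^ k i := by
    intro i
    rcases Nat.eq_zero_or_pos (k i) with h0 | h0
    · simp [h0]
    have hdvd : P i ∣ p ^ N := by
      rw [← hG, Nat.card_congr f.toEquiv, Nat.card_pi]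
      refine (dvd_pow_self (P i) h0.ne').trans ?_
      simpa using dvd_prod_of_mem (fun j => Nat.card (ZMod (P j ^ k j))) (mem_univ i)
    rw [(Nat.prime_dvd_prime_iff_eq (hP i) hp).1 ((hP i).dvd_of_dvd_pow hdvd)]
  let e : ι → G := fun i => f.symm (Pi.single i 1)
  have hfe : ∀ i, f (e i) = Pi.single i 1 := fun i => f.apply_symm_apply _
  refine ⟨ι, inferInstance, e, k, fun i => ?_, ?_, ?_⟩
  · apply f.injective
    rw [map_nsmul, hfe, map_zero, ← Pi.single_smul, nsmul_one, ← hpk, ZMod.natCast_self,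
      Pi.single_zero]
  · rw [eq_top_iff]
    intro x _
    have hx : x = ∑ i, (ZMod.cast (f x i) : ℤ) • e i := by
      apply f.injective
      simp only [map_sum, map_zsmul, hfe]
      ext j
      rw [Finset.sum_apply, sum_eq_single j]
      · simp
      · intro i _ hij
        simp [Pi.single_eq_of_ne' hij]
      · simp
    rw [hx]
    exact AddSubgroup.sum_mem _ fun i _ =>
      zsmul_mem (AddSubgroup.subset_closure (Set.mem_range_self i)) _
  · by_contra! hle
    let M : Multiset G := ∑ i, Multiset.replicate (p ^ k i - 1) (e i)
    have hMcard : Multiset.card M = ∑ i, (p ^ k i - 1) := by simp [M]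
    obtain ⟨T, hTM, hT0, hTsum⟩ := davenport_mem M (hle.trans hMcard.ge)
    have hmemM : ∀ a ∈ M, ∃ i, a = e i ∧ p ^ k i - 1 ≠ 0 := by
      intro a ha
      obtain ⟨i, -, hi⟩ := Multiset.mem_sum.1 ha
      exact ⟨i, (Multiset.mem_replicate.1 hi).2, (Multiset.mem_replicate.1 hi).1⟩
    have hcoord : ∀ a ∈ T, ∀ j, f a j = 0 := by
      intro a ha j
      have hcount : T.countP (fun a => f a j ≠ 0) < p ^ k j := by
        have hle := Multiset.countP_le_of_le (fun a => f a j ≠ 0) hTM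
        have : M.countP (fun a => f a j ≠ 0) ≤ p ^ k j - 1 := by
          have : M.countP (fun a => f a j ≠ 0) =
              ∑ i, (Multiset.replicate (p ^ k i - 1) (e i)).countP (fun a => f a j ≠ 0) :=
            map_sum (Multiset.countPAddMonoidHom (fun a => f a j ≠ 0)) _ _
          rw [this, sum_eq_single j]
          · exact (Multiset.countP_le_card _ _).trans_eq (Multiset.card_replicate _ _)
          · intro i _ hij
            rw [Multiset.countP_eq_zero]
            intro b hb
            rw [(Multiset.mem_replicate.1 hb).2, hfe]
            simp [Pi.single_eq_of_ne' hij]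
          · simp
        have := pow_pos hp.pos (k j)
        lia
      have hsum : ((T.countP (fun a => f a j ≠ 0) : ℕ) : ZMod (P j ^ k j)) = f T.sum j := by
        have : ∀ T ≤ M, ((T.countP (fun a => f a j ≠ 0) : ℕ) : ZMod (P j ^ k j)) = f T.sum j := by
          intro T hTM
          induction T using Multiset.induction_on with
          | empty => simp
          | cons a T ih =>
            obtain ⟨i, rfl, -⟩ := hmemM a (Multiset.mem_of_le hTM (by simp))
            rw [Multiset.countP_cons, Nat.cast_add, ih ((Multiset.le_cons_self _ _).trans hTM),
              Multiset.sum_cons, map_add, Pi.add_apply, add_comm, hfe]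
            congr 1
            rcases eq_or_ne i j with rfl | hij
            · by_cases h1 : (1 : ZMod (P i ^ k i)) = 0 <;> simp [h1]
            · simp [Pi.single_eq_of_ne' hij]
        exact this T hTM
      rw [hTsum, map_zero, Pi.zero_apply, ZMod.natCast_eq_zero_iff] at hsum
      have := Nat.eq_zero_of_dvd_of_lt hsum (hcount.trans_eq (hpk j).symm)
      rw [Multiset.countP_eq_zero] at this
      exact not_not.1 (this a ha)
    obtain ⟨a, ha⟩ := Multiset.exists_mem_of_ne_zero hT0
    obtain ⟨i, rfl, hi⟩ := hmemM a (Multiset.mem_of_le hTM ha)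
    have h1 := hcoord _ ha i
    rw [hfe, Pi.single_eq_same] at h1
    have : P i ^ k i = 1 := by
      rw [← Nat.cast_one, ZMod.natCast_eq_zero_iff] at h1
      exact Nat.dvd_one.1 h1
    rw [hpk] at this
    lia

end Davenport

section Main

theorem exists_short_of_two_mul_lt {p : ℕ} [hp : Fact p.Prime] {G β ι : Type*} [AddCommGroup G]
    [Fintype ι] {n m : ℕ} (hm : 0 < m) (e : ι → G) (k : ι → ℕ) (he : ∀ i, p ^ k i • e i = 0)
    (hk : ∑ i, (p ^ k i - 1) + 1 ≤ 2 * p ^ n - 1) (φ : G →+ ZMod m)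
    (hφ : ∀ x, φ x = 0 → x ∈ AddSubgroup.closure (Set.range e)) (I : Finset β) (g : β → G)
    (hsum : ∑ b ∈ I, g b = 0) (hI : 2 * (p ^ n * m) < #I) :
    ∃ T ⊆ I, T.Nonempty ∧ #T ≤ p ^ n * m ∧ ∑ b ∈ T, g b = 0 := by
  classical
  have hq : 0 < p ^ n := pow_pos hp.out.pos n
  set q := p ^ n with hq_def
  have hvanish : ∀ (s : Finset ℕ) (h : ℕ → G), (∀ i ∈ s, φ (h i) = 0) →
      ∀ s' ⊆ s, 2 * q - 1 ≤ #s' → ∀ c,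
        ∑ T ∈ s'.powerset with ∑ b ∈ T, h b = c, (-1 : ZMod p) ^ #T = 0 := by
    intro s h hs s' hs' hcard c
    exact sum_neg_one_pow_card_eq_zero s' h (prod_one_sub_single_eq_zero e k he s' h
      (fun b hb => hφ _ (hs b (hs' hb))) (hk.trans hcard)) c
  have hblock {l : ℕ} {B : ℕ → Finset β}
      (hB : ∀ i ∈ range l, B i ⊆ I ∧ #(B i) = m ∧ ∑ b ∈ B i, φ (g b) = 0)
      (hdis : Set.PairwiseDisjoint (range l : Set ℕ) B) {T : Finset ℕ} (hT : T ⊆ range l) :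
      T.biUnion B ⊆ I ∧ #(T.biUnion B) = #T * m ∧
        ∑ b ∈ T.biUnion B, g b = ∑ i ∈ T, ∑ b ∈ B i, g b := by
    have hdisT : Set.PairwiseDisjoint (T : Set ℕ) B := hdis.subset (by exact_mod_cast hT)
    refine ⟨biUnion_subset.2 fun i hi => (hB i (hT hi)).1, ?_, sum_biUnion hdisT⟩
    rw [card_biUnion hdisT, sum_congr rfl fun i hi => (hB i (hT hi)).2.1]
    simp
  have hshort {l : ℕ} {B : ℕ → Finset β}
      (hB : ∀ i ∈ range l, B i ⊆ I ∧ #(B i) = m ∧ ∑ b ∈ B i, φ (g b) = 0)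
      (hdis : Set.PairwiseDisjoint (range l : Set ℕ) B)
      (h : ∃ T ⊆ range l, T.Nonempty ∧ #T ≤ q ∧ ∑ i ∈ T, ∑ b ∈ B i, g b = 0) :
      ∃ T ⊆ I, T.Nonempty ∧ #T ≤ q * m ∧ ∑ b ∈ T, g b = 0 := by
    obtain ⟨T, hT, hne, hcard, hzero⟩ := h
    obtain ⟨h1, h2, h3⟩ := hblock hB hdis hT
    refine ⟨T.biUnion B, h1, ?_, ?_, h3.trans hzero⟩
    · rw [← card_pos, h2]
      exact Nat.mul_pos hne.card_pos hm
    · rw [h2]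
      exact Nat.mul_le_mul_right m hcard
  obtain ⟨r, s, hs, hIcard⟩ : ∃ r s, s < m ∧ #I = (2 * q + r) * m + s := by
    refine ⟨(#I - 2 * (q * m)) / m, (#I - 2 * (q * m)) % m, Nat.mod_lt _ hm, ?_⟩
    have := Nat.div_add_mod' (#I - 2 * (q * m)) m
    rw [add_mul]
    lia
  by_cases hr : r < q
  · obtain ⟨l, hl⟩ : ∃ l, l + 1 = 2 * q + r := ⟨2 * q + r - 1, by lia⟩
    have hlI : #I = l * m + m + s := by rw [hIcard, ← hl]; ring
    obtain ⟨B, hB, hdis⟩ := exists_disjoint_blocks hm I (fun b => φ (g b)) l (by lia)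
    obtain ⟨hUI, hUcard, hUsum⟩ := hblock hB hdis Subset.rfl
    set U := (range l).biUnion B
    have hrest := sum_sdiff (f := g) hUI
    rw [hsum, hUsum, add_comm] at hrest
    rcases exists_short_or_of_sum_add_eq_zero (s := range l) (r := r)
      (hvanish _ (fun i => ∑ b ∈ B i, g b) (fun i hi => by rw [map_sum, (hB i hi).2.2]))
      hr (by simpa using hl) hrest with h | ⟨T, hT, hTcard, hTsum⟩
    · exact hshort hB hdis h
    · obtain ⟨h1, h2, h3⟩ := hblock hB hdis hT
      have hdisj : Disjoint (T.biUnion B) (I \ U) :=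
        disjoint_of_subset_left (biUnion_subset_biUnion_of_subset_left B hT) disjoint_sdiff
      have hcard : #(T.biUnion B ∪ I \ U) = #T * m + (m + s) := by
        rw [card_union_of_disjoint hdisj, h2, card_sdiff_of_subset hUI, hUcard, card_range, hlI]
        lia
      refine ⟨T.biUnion B ∪ I \ U, union_subset h1 sdiff_subset, card_pos.1 (by lia), ?_, ?_⟩
      · have := Nat.mul_le_mul_right m hTcard
        rw [add_mul] at this
        lia
      · rw [sum_union hdisj, h3, hTsum]
  · have hbig : 3 * q * m ≤ #I := by
      have := Nat.mul_le_mul_right m (show 3 * q ≤ 2 * q + r by lia)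
      lia
    have hlm : (3 * q - 1) * m + m = 3 * q * m := by
      rw [← Nat.succ_mul, Nat.succ_eq_add_one, Nat.sub_add_cancel (by lia)]
    obtain ⟨B, hB, hdis⟩ := exists_disjoint_blocks hm I (fun b => φ (g b)) (3 * q - 1) (by lia)
    exact hshort hB hdis (exists_short_of_three_mul_le
      (hvanish _ _ (fun i hi => by rw [map_sum, (hB i hi).2.2])) (by simp [hq_def]))

theorem le_exponent_zmod_prod {N : ℕ} [NeZero N] (H : Type*) [AddCommGroup H] [Finite H] :
    N ≤ AddMonoid.exponent (ZMod N × H) := by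
  have h := AddMonoid.addOrder_dvd_exponent ((1, 0) : ZMod N × H)
  refine Nat.le_of_dvd (Nat.pos_of_ne_zero AddMonoid.exponent_ne_zero_of_finite) (dvd_trans ?_ h)
  rw [Prod.addOrderOf_mk, ZMod.addOrderOf_one]
  exact Nat.dvd_lcm_left _ _

theorem hasShortZeroSumSubseq_of_card_le {G : Type*} [AddCommGroup G] [Finite G] {S : Multiset G}
    (hS : davenport G + 1 ≤ Multiset.card S) (hsum : S.sum = 0)
    (hle : Multiset.card S ≤ 2 * AddMonoid.exponent G) : HasShortZeroSumSubseq S := by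
  classical
  obtain ⟨a, ha⟩ := Multiset.card_pos_iff_exists_mem.1 (show 0 < Multiset.card S by lia)
  obtain ⟨S', rfl⟩ := Multiset.exists_cons_of_mem ha
  rw [Multiset.card_cons] at hS hle
  obtain ⟨T, hT, hT0, hTsum⟩ := davenport_mem S' (by lia)
  obtain ⟨V, rfl⟩ := Multiset.le_iff_exists_add.1 hT
  have hTpos := Multiset.card_pos.2 hT0
  rw [Multiset.card_add] at hle
  by_cases h : Multiset.card T ≤ AddMonoid.exponent G
  · exact ⟨T, hT.trans (Multiset.le_cons_self _ _), hTsum, hTpos, h⟩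
  · refine ⟨a ::ₘ V, Multiset.cons_le_cons a (Multiset.le_add_left _ _), ?_, by simp, ?_⟩
    · rwa [← Multiset.add_cons, Multiset.sum_add, hTsum, zero_add] at hsum
    · rw [Multiset.card_cons]
      lia

theorem hasShortZeroSumSubseq_zmod_prod {p : ℕ} (hp : p.Prime) {H : Type*} [AddCommGroup H]
    [Finite H] {N : ℕ} (hH : Nat.card H = p ^ N) {n m : ℕ} (hm : 0 < m)
    (hD : davenport H ≤ p ^ n) {S : Multiset (ZMod (p ^ n * m) × H)}
    (hS : davenport (ZMod (p ^ n * m) × H) + 1 ≤ Multiset.card S) (hsum : S.sum = 0) :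
    HasShortZeroSumSubseq S := by
  classical
  have : Fact p.Prime := ⟨hp⟩
  have : NeZero (p ^ n * m) := ⟨(Nat.mul_pos (pow_pos hp.pos n) hm).ne'⟩
  have hexp := le_exponent_zmod_prod (N := p ^ n * m) H
  by_cases hle : Multiset.card S ≤ 2 * (p ^ n * m)
  · exact hasShortZeroSumSubseq_of_card_le hS hsum (by lia)
  obtain ⟨ι, _, e, k, he, hcl, hlt⟩ := exists_basis_sum_lt_davenport hp hH
  let E : Option ι → ZMod (p ^ n * m) × H := fun o => o.elim ((m : ℕ), 0) fun i => (0, e i)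
  let φ : ZMod (p ^ n * m) × H →+ ZMod m :=
    (ZMod.castHom (dvd_mul_left m (p ^ n)) (ZMod m)).toAddMonoidHom.comp (AddMonoidHom.fst _ _)
  have hE : ∀ o, p ^ (o.elim n k) • E o = 0 := by
    rintro (_ | i)
    · simp only [E, Option.elim, Prod.smul_mk, smul_zero, nsmul_eq_mul]
      rw [← Nat.cast_mul, ZMod.natCast_self]
      rfl
    · simp [E, he]
  have hφ : ∀ x, φ x = 0 → x ∈ AddSubgroup.closure (Set.range E) := by
    rintro ⟨a, b⟩ hab
    obtain ⟨c, rfl⟩ : ∃ c : ℕ, a = (m : ℕ) * (c : ℕ) := by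
      have h0 : (ZMod.castHom (dvd_mul_left m (p ^ n)) (ZMod m)) a = 0 := hab
      rw [← ZMod.natCast_zmod_val a, map_natCast, ZMod.natCast_eq_zero_iff] at h0
      obtain ⟨c, hc⟩ := h0
      exact ⟨c, by rw [← Nat.cast_mul, ← hc, ZMod.natCast_zmod_val]⟩
    have hsplit : (((m : ℕ) * (c : ℕ), b) : ZMod (p ^ n * m) × H) =
        c • E none + AddMonoidHom.inr (ZMod (p ^ n * m)) H b := by
      simp [E, mul_comm]
    rw [hsplit]
    refine add_mem (nsmul_mem (AddSubgroup.subset_closure (Set.mem_range_self _)) _) ?_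
    have hb : AddMonoidHom.inr (ZMod (p ^ n * m)) H b ∈
        (AddSubgroup.closure (Set.range e)).map (AddMonoidHom.inr (ZMod (p ^ n * m)) H) :=
      AddSubgroup.mem_map_of_mem _ (by simp [hcl])
    rw [AddMonoidHom.map_closure] at hb
    refine AddSubgroup.closure_mono ?_ hb
    rintro _ ⟨_, ⟨i, rfl⟩, rfl⟩
    exact ⟨some i, rfl⟩
  have hsum' : ∑ b ∈ S.toEnumFinset, b.1 = 0 := by
    rw [← hsum, sum_eq_multiset_sum, Multiset.map_toEnumFinset_fst]
  obtain ⟨T, hTS, hT, hTcard, hTsum⟩ := exists_short_of_two_mul_lt (n := n) hm E (fun o => o.elim n k) hE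
    (by rw [Fintype.sum_option]; simp only [Option.elim]; lia) φ hφ S.toEnumFinset Prod.fst hsum'
    (by rw [Multiset.card_toEnumFinset]; lia)
  refine ⟨T.1.map Prod.fst, Multiset.map_fst_le_of_subset_toEnumFinset hTS, hTsum, ?_, ?_⟩
  · simpa using hT.card_pos
  · simpa using hTcard.trans hexp

end Main

end ZeroSum

theorem stmt_8 (p : ℕ) (hp : p.Prime) (H : Type*) [AddCommGroup H] [Fintype H]
    [Nontrivial H] (hHp : ∃ k : ℕ, Fintype.card H = p ^ k)
    (n m : ℕ) (hn : 0 < n) (hm : 0 < m) (hpD : davenport H ≤ p ^ n) :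
    C0 (ZMod (p ^ n * m) × H) =
      Set.Icc (davenport (ZMod (p ^ n * m) × H) + 1) (etaConst (ZMod (p ^ n * m) × H) - 1) := by
  obtain ⟨k, hk⟩ := hHp
  ext t
  refine ⟨fun h => ⟨h.1, h.2.1⟩, fun h => ⟨h.1, h.2, fun S hS hsum => ?_⟩⟩
  subst hS
  exact ZeroSum.hasShortZeroSumSubseq_zmod_prod hp (Nat.card_eq_fintype_card.trans hk) hm hpD
    h.1 hsum
end

section
/- For the group G = C_3^4 (the direct sum of four copies of the cyclic group of order 3), C_0(G) = {37, 38}; that is, the integers t in [D(G)+1, η(G)-1] such that every zero-sum sequence over G of length exactly t contains a short zero-sum subsequence are precisely t = 37 = η(C_3^4) - 2 and t = 38 = η(C_3^4) - 1. -/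
namespace CapSet

open Finset Module

section Counting

variable {V : Type*} [AddCommGroup V] [Module (ZMod 3) V]

lemma linearIndependent_of_threeAPFree {C : Set V} (hC : ThreeAPFree C) {x y z : V}
    (hx : x ∈ C) (hy : y ∈ C) (hz : z ∈ C) (hxy : x ≠ y) (hxz : x ≠ z) (hyz : y ≠ z) :
    LinearIndependent (ZMod 3) ![y - x, z - x] := by
  rw [LinearIndependent.pair_iff' (sub_ne_zero.2 hxy.symm)]
  intro a ha
  have hcases : ∀ a : ZMod 3, a = 0 ∨ a = 1 ∨ a = 1 + 1 := by decide
  obtain rfl | rfl | rfl := hcases a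
  · rw [zero_smul] at ha
    exact hxz (sub_eq_zero.1 ha.symm).symm
  · rw [one_smul] at ha
    exact hyz (sub_left_injective ha)
  · rw [add_smul, one_smul] at ha
    have hz' : z + x = y + y := by
      rw [← sub_add_cancel z x, ← ha]
      abel
    exact hyz (hC hz hy hx hz').symm

/-- The number of points of `C` on the hyperplane `u = t`. -/
def level (C : Finset V) (u : Dual (ZMod 3) V) (t : ZMod 3) : ℕ := #{x ∈ C | u x = t}

lemma level_zero_apply (C : Finset V) (x : V) :
    level C (0 : Dual (ZMod 3) V) ((0 : Dual (ZMod 3) V) x) = #C := by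
  simp [level]

lemma level_neg (C : Finset V) (u : Dual (ZMod 3) V) (x : V) :
    level C (-u) (-u x) = level C u (u x) := by
  simp [level]

lemma sum_comp_apply {R : Type*} [AddCommMonoid R] (C : Finset V) (u : Dual (ZMod 3) V)
    (f : ZMod 3 → R) :
    ∑ x ∈ C, f (u x) = level C u 0 • f 0 + level C u 1 • f 1 + level C u 2 • f 2 := by
  rw [← sum_fiberwise C u (fun x ↦ f (u x))]
  have h (t : ZMod 3) : ∑ x ∈ C with u x = t, f (u x) = level C u t • f t := by
    rw [sum_congr rfl fun x hx ↦ by rw [(mem_filter.1 hx).2], sum_const, level]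
  simp_rw [h]
  exact Fin.sum_univ_three _

lemma level_add (C : Finset V) (u : Dual (ZMod 3) V) :
    level C u 0 + level C u 1 + level C u 2 = #C := by
  simpa using (sum_comp_apply C u fun _ ↦ (1 : ℕ)).symm

lemma level_le {u : Dual (ZMod 3) V} {b : ℕ}
    (hb : ∀ D : Finset (LinearMap.ker u), ThreeAPFree (D : Set (LinearMap.ker u)) → #D ≤ b)
    {C : Finset V} (hC : ThreeAPFree (C : Set V)) (t : ZMod 3) : level C u t ≤ b := by
  classical
  obtain h | ⟨p, hp⟩ := {x ∈ C | u x = t}.eq_empty_or_nonempty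
  · simp [level, h]
  have hinj : Function.Injective fun x : LinearMap.ker u ↦ (x : V) + p :=
    fun x y h ↦ Subtype.ext (add_right_cancel h)
  refine le_trans ?_ (hb ({x ∈ C | u x = t}.preimage _ hinj.injOn) fun x hx y hy z hz h ↦ ?_)
  · have hrange : ∀ x ∈ {x ∈ C | u x = t}, x ∈ Set.range fun x : LinearMap.ker u ↦ (x : V) + p := by
      refine fun x hx ↦ ⟨⟨x - p, ?_⟩, sub_add_cancel x p⟩
      rw [LinearMap.mem_ker, map_sub, (mem_filter.1 hx).2, (mem_filter.1 hp).2, sub_self]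
    rw [card_preimage, filter_true_of_mem hrange, level]
  · simp only [coe_preimage, Set.mem_preimage, mem_coe, mem_filter] at hx hy hz
    refine hinj (hC hx.1 hy.1 hz.1 ?_)
    have h' : (x : V) + z = y + y := congrArg Subtype.val h
    rw [add_add_add_comm, h', add_add_add_comm]

lemma card_dual [Fintype (Dual (ZMod 3) V)] {d : ℕ} (hd : finrank (ZMod 3) V = d) :
    Fintype.card (Dual (ZMod 3) V) = 3 ^ d := by
  rw [Module.card_eq_pow_finrank (K := ZMod 3), Subspace.dual_finrank_eq, hd, ZMod.card]

variable [FiniteDimensional (ZMod 3) V] [Fintype (Dual (ZMod 3) V)]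

lemma card_filter_forall_apply_eq_zero (s : Set V) [DecidablePred fun u : Dual (ZMod 3) V ↦
    ∀ v ∈ s, u v = 0] :
    #{u : Dual (ZMod 3) V | ∀ v ∈ s, u v = 0} =
      3 ^ (finrank (ZMod 3) V - finrank (ZMod 3) (Submodule.span (ZMod 3) s)) := by
  have h := Subspace.finrank_add_finrank_dualAnnihilator_eq (Submodule.span (ZMod 3) s)
  have hc := Module.natCard_eq_pow_finrank (K := ZMod 3)
    (V := (Submodule.span (ZMod 3) s).dualAnnihilator)
  rw [Nat.card_zmod] at hc
  rw [← h, Nat.add_sub_cancel_left, ← hc, ← Fintype.card_subtype, ← Nat.card_eq_fintype_card]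
  refine Nat.card_congr (Equiv.subtypeEquivRight fun u ↦ ?_)
  rw [← SetLike.mem_coe, Submodule.coe_dualAnnihilator_span]
  rfl

lemma card_filter_apply_eq {d : ℕ} (hd : finrank (ZMod 3) V = d + 2) {x y : V} (hxy : y ≠ x) :
    #{u : Dual (ZMod 3) V | u y = u x} = 3 ^ (d + 1) := by
  classical
  have h := card_filter_forall_apply_eq_zero ({y - x} : Set V)
  rw [finrank_span_singleton (sub_ne_zero.2 hxy), hd, show d + 2 - 1 = d + 1 from rfl] at h
  simpa [sub_eq_zero] using h

lemma card_filter_apply_eq_and {C : Set V} (hC : ThreeAPFree C) {d : ℕ}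
    (hd : finrank (ZMod 3) V = d + 2) {x y z : V} (hx : x ∈ C) (hy : y ∈ C) (hz : z ∈ C)
    (hxy : x ≠ y) (hxz : x ≠ z) (hyz : y ≠ z) :
    #{u : Dual (ZMod 3) V | u y = u x ∧ u z = u x} = 3 ^ d := by
  classical
  have h := card_filter_forall_apply_eq_zero (Set.range ![z - x, y - x])
  rw [finrank_span_eq_card (linearIndependent_of_threeAPFree hC hx hz hy hxz hxy hyz.symm), hd,
    Fintype.card_fin, Nat.add_sub_cancel] at h
  simpa [sub_eq_zero] using h

lemma sum_level {C : Finset V} {d n : ℕ} (hd : finrank (ZMod 3) V = d + 2) (hn : #C = n + 1)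
    {x : V} (hx : x ∈ C) :
    ∑ u : Dual (ZMod 3) V, level C u (u x) = 3 ^ (d + 2) + n * 3 ^ (d + 1) := by
  classical
  simp_rw [level, card_filter]
  rw [sum_comm, ← add_sum_erase _ _ hx]
  simp_rw [← card_filter]
  rw [sum_congr rfl fun y hy ↦ card_filter_apply_eq hd (ne_of_mem_erase hy), sum_const,
    card_erase_of_mem hx, hn]
  simp [card_dual hd]

lemma sum_level_sq {C : Finset V} (hC : ThreeAPFree (C : Set V)) {d n : ℕ}
    (hd : finrank (ZMod 3) V = d + 2) (hn : #C = n + 2) {x : V} (hx : x ∈ C) :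
    ∑ u : Dual (ZMod 3) V, level C u (u x) ^ 2 =
      3 ^ (d + 2) + (n + 1) * 3 ^ (d + 1) + (n + 1) * (2 * 3 ^ (d + 1) + n * 3 ^ d) := by
  classical
  have h (u : Dual (ZMod 3) V) : level C u (u x) ^ 2 =
      ∑ y ∈ C, ∑ z ∈ C, if u y = u x ∧ u z = u x then 1 else 0 := by
    simp_rw [level, card_filter, sq, sum_mul_sum, ite_and, ite_mul, one_mul, zero_mul]
  simp_rw [h]
  rw [sum_comm, ← add_sum_erase _ _ hx]
  simp_rw [true_and]
  congr 1
  · rw [← sum_level hd hn hx]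
    simp_rw [level, card_filter]
  · trans ∑ y ∈ C.erase x, (2 * 3 ^ (d + 1) + n * 3 ^ d)
    · refine sum_congr rfl fun y hy ↦ ?_
      have hyx := ne_of_mem_erase hy
      rw [sum_comm, ← add_sum_erase _ _ hx, ← add_sum_erase _ _ hy]
      simp_rw [← card_filter]
      have hz : ∀ z ∈ (C.erase x).erase y,
          #{u : Dual (ZMod 3) V | u y = u x ∧ u z = u x} = 3 ^ d := fun z hz ↦
        card_filter_apply_eq_and hC hd hx (mem_of_mem_erase hy)
          (mem_of_mem_erase (mem_of_mem_erase hz)) hyx.symm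
          (ne_of_mem_erase (mem_of_mem_erase hz)).symm (ne_of_mem_erase hz).symm
      rw [sum_congr rfl hz, sum_const, card_erase_of_mem hy, card_erase_of_mem hx, hn]
      simp only [and_true, and_self, card_filter_apply_eq hd hyx, smul_eq_mul]
      simp
      ring
    · rw [sum_const, card_erase_of_mem hx, hn]
      simp

lemma sum_sum_level {C : Finset V} {d n : ℕ} (hd : finrank (ZMod 3) V = d + 2)
    (hn : #C = n + 1) :
    ∑ u : Dual (ZMod 3) V, ∑ x ∈ C, level C u (u x) =
      (n + 1) * (3 ^ (d + 2) + n * 3 ^ (d + 1)) := by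
  rw [sum_comm, sum_congr rfl fun x hx ↦ sum_level hd hn hx, sum_const, hn, smul_eq_mul]

lemma sum_sum_level_sq {C : Finset V} (hC : ThreeAPFree (C : Set V)) {d n : ℕ}
    (hd : finrank (ZMod 3) V = d + 2) (hn : #C = n + 2) :
    ∑ u : Dual (ZMod 3) V, ∑ x ∈ C, level C u (u x) ^ 2 =
      (n + 2) * (3 ^ (d + 2) + (n + 1) * 3 ^ (d + 1) +
        (n + 1) * (2 * 3 ^ (d + 1) + n * 3 ^ d)) := by
  rw [sum_comm, sum_congr rfl fun x hx ↦ sum_level_sq hC hd hn hx, sum_const, hn, smul_eq_mul]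

end Counting

section Bounds

variable {V : Type*} [AddCommGroup V] [Module (ZMod 3) V] {C : Finset V}

lemma card_le_two (hV : finrank (ZMod 3) V = 1) (hC : ThreeAPFree (C : Set V)) : #C ≤ 2 := by
  by_contra! h
  have : FiniteDimensional (ZMod 3) V := .of_finrank_pos (by lia)
  obtain ⟨x, y, z, hx, hy, hz, hxy, hxz, hyz⟩ := two_lt_card_iff.1 h
  have := (linearIndependent_of_threeAPFree hC hx hy hz hxy hxz hyz).fintype_card_le_finrank
  simp [hV] at this

lemma finrank_ker {d : ℕ} (hV : finrank (ZMod 3) V = d + 1) {u : Dual (ZMod 3) V} (hu : u ≠ 0) :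
    finrank (ZMod 3) (LinearMap.ker u) = d := by
  have : FiniteDimensional (ZMod 3) V := .of_finrank_pos (by lia)
  have := Module.Dual.finrank_ker_add_one_of_ne_zero hu
  lia

lemma card_dual_ne_zero [DecidableEq (Dual (ZMod 3) V)] [Fintype (Dual (ZMod 3) V)] {d : ℕ}
    (hV : finrank (ZMod 3) V = d) :
    #((univ : Finset (Dual (ZMod 3) V)).erase 0) = 3 ^ d - 1 := by
  rw [card_erase_of_mem (mem_univ _), card_univ, card_dual hV]

lemma sum_level_le_of_forall_le {d n b : ℕ} (hV : finrank (ZMod 3) V = d + 2) (hn : #C = n + 1)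
    (hb : ∀ u : Dual (ZMod 3) V, u ≠ 0 → ∑ x ∈ C, level C u (u x) ≤ b) :
    (n + 1) * (3 ^ (d + 2) + n * 3 ^ (d + 1)) ≤ (n + 1) ^ 2 + (3 ^ (d + 2) - 1) * b := by
  classical
  have : FiniteDimensional (ZMod 3) V := .of_finrank_pos (by lia)
  have : Finite (Dual (ZMod 3) V) := Module.finite_of_finite (ZMod 3)
  have := Fintype.ofFinite (Dual (ZMod 3) V)
  rw [← sum_sum_level hV hn, ← add_sum_erase _ _ (mem_univ 0), ← card_dual_ne_zero hV]
  simp_rw [level_zero_apply, sum_const, hn, sq, smul_eq_mul]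
  exact Nat.add_le_add_left (sum_le_card_nsmul _ _ _ fun u hu ↦ hb u (ne_of_mem_erase hu)) _

lemma card_le_four (hV : finrank (ZMod 3) V = 2) (hC : ThreeAPFree (C : Set V)) : #C ≤ 4 := by
  by_contra! h
  obtain ⟨D, hDC, hD⟩ := exists_subset_card_eq h
  have := sum_level_le_of_forall_le (d := 0) (n := 4) (b := 9) hV hD fun u hu ↦ by
    have hl := level_le (fun E ↦ card_le_two (finrank_ker hV hu)) (hC.mono (coe_subset.2 hDC))
    have hadd := level_add D u
    rw [sum_comp_apply]
    have h0 := hl 0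
    have h1 := hl 1
    have h2 := hl 2
    generalize level D u 0 = a, level D u 1 = b, level D u 2 = c at *
    interval_cases a <;> interval_cases b <;> interval_cases c <;> simp_all
  simp at this

lemma card_le_nine (hV : finrank (ZMod 3) V = 3) (hC : ThreeAPFree (C : Set V)) : #C ≤ 9 := by
  by_contra! h
  obtain ⟨D, hDC, hD⟩ := exists_subset_card_eq h
  have := sum_level_le_of_forall_le (d := 1) (n := 9) (b := 36) hV hD fun u hu ↦ by
    have hl := level_le (fun E ↦ card_le_four (finrank_ker hV hu)) (hC.mono (coe_subset.2 hDC))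
    have hadd := level_add D u
    rw [sum_comp_apply]
    have h0 := hl 0
    have h1 := hl 1
    have h2 := hl 2
    generalize level D u 0 = a, level D u 1 = b, level D u 2 = c at *
    interval_cases a <;> interval_cases b <;> interval_cases c <;> simp_all
  simp at this

lemma level_le_nine (hV : finrank (ZMod 3) V = 4) (hC : ThreeAPFree (C : Set V))
    {u : Dual (ZMod 3) V} (hu : u ≠ 0) (t : ZMod 3) : level C u t ≤ 9 :=
  level_le (fun _ ↦ card_le_nine (finrank_ker hV hu)) hC t

lemma neg_ne_self {u : Dual (ZMod 3) V} (hu : u ≠ 0) : -u ≠ u := by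
  refine fun h ↦ hu (LinearMap.ext fun x ↦ ?_)
  have h3 : ∀ a : ZMod 3, -a = a → a = 0 := by decide
  exact h3 _ (LinearMap.congr_fun h x)

/-- Hyperplanes meet a 21-point cap of `𝔽₃⁴` with pattern `(7, 7, 7)` or `(9, 9, 3)`; the number of
linear forms of the second kind would be `35`, but forms come in pairs `±u`. -/
lemma card_ne_twenty_one (hV : finrank (ZMod 3) V = 4) (hC : ThreeAPFree (C : Set V)) :
    #C ≠ 21 := by
  classical
  intro hn
  have : FiniteDimensional (ZMod 3) V := .of_finrank_pos (by lia)
  have : Finite (Dual (ZMod 3) V) := Module.finite_of_finite (ZMod 3)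
  have := Fintype.ofFinite (Dual (ZMod 3) V)
  have h2 := sum_sum_level (d := 2) (n := 20) hV hn
  have h3 := sum_sum_level_sq (d := 2) (n := 19) hC hV hn
  rw [← add_sum_erase _ _ (mem_univ 0)] at h2 h3
  simp_rw [level_zero_apply, sum_const, hn, smul_eq_mul] at h2 h3
  have hcard := card_dual_ne_zero hV
  set S := (univ : Finset (Dual (ZMod 3) V)).erase 0
  have hS : ∀ u ∈ S, 19 * ∑ x ∈ C, level C u (u x) ≤ ∑ x ∈ C, level C u (u x) ^ 2 + 1764 ∧
      (19 * ∑ x ∈ C, level C u (u x) = ∑ x ∈ C, level C u (u x) ^ 2 + 1764 →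
        ∑ x ∈ C, level C u (u x) =
          147 + 24 * if ∑ x ∈ C, level C u (u x) = 171 then 1 else 0) := by
    intro u hu
    have hl := level_le_nine hV hC (ne_of_mem_erase hu)
    have h0 := hl 0
    have h1 := hl 1
    have h2 := hl 2
    have hadd := level_add C u
    rw [hn] at hadd
    rw [sum_comp_apply, sum_comp_apply C u fun t ↦ level C u t ^ 2]
    generalize level C u 0 = a, level C u 1 = b, level C u 2 = c at *
    obtain rfl : c = 21 - a - b := by lia
    clear hl hn
    interval_cases a <;> interval_cases b <;> lia
  have heq := (sum_eq_sum_iff_of_le fun u hu ↦ (hS u hu).1).1 <| by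
    rw [← mul_sum, sum_add_distrib, sum_const, hcard]
    simp at h2 h3 ⊢
    lia
  rw [sum_congr rfl fun u hu ↦ (hS u hu).2 (heq u hu), sum_add_distrib, ← mul_sum, sum_const,
    hcard, ← card_filter] at h2
  have hinv : ∑ u ∈ S with ∑ x ∈ C, level C u (u x) = 171, (1 : ZMod 2) = 0 := by
    refine sum_involution (fun u _ ↦ -u) (fun _ _ ↦ by decide)
      (fun u hu _ ↦ neg_ne_self (ne_of_mem_erase (mem_filter.1 hu).1)) (fun u hu ↦ ?_)
      fun u _ ↦ neg_neg u
    simpa [S, level_neg] using hu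
  rw [sum_const, nsmul_one, ZMod.natCast_eq_zero_iff] at hinv
  lia

lemma card_le_twenty (hV : finrank (ZMod 3) V = 4) (hC : ThreeAPFree (C : Set V)) : #C ≤ 20 := by
  by_contra! h
  obtain ⟨D, hDC, hD⟩ := exists_subset_card_eq h
  exact card_ne_twenty_one hV (hC.mono (coe_subset.2 hDC)) hD

lemma level_pattern_le {l : ZMod 3 → ℕ} {k : ZMod 3} (hl : ∀ t, l t ≤ 9)
    (hadd : l 0 + l 1 + l 2 = 20) (hdvd : 3 ∣ l 1 + 2 * l 2 + k.val) :
    18 * (l 0 • l 0 + l 1 • l 1 + l 2 • l 2) + 3 * l k ≤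
      l 0 • l 0 ^ 2 + l 1 • l 1 ^ 2 + l 2 • l 2 ^ 2 + 1528 := by
  have key : ∀ a < 10, ∀ b < 10, ∀ c < 10, a + b + c = 20 → ∀ i : Fin 3,
      3 ∣ b + 2 * c + i.val → 18 * (a * a + b * b + c * c) + 3 * ![a, b, c] i ≤
        a * a ^ 2 + b * b ^ 2 + c * c ^ 2 + 1528 := by
    decide +kernel
  have hk : l k = ![l 0, l 1, l 2] k := by
    fin_cases k <;> rfl
  rw [hk]
  exact key _ (Nat.lt_succ_of_le (hl 0)) _ (Nat.lt_succ_of_le (hl 1)) _ (Nat.lt_succ_of_le (hl 2))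
    hadd k hdvd

/-- A 20-point cap `C` of `𝔽₃⁴` does not contain the point `-∑ x ∈ C, x`. -/
lemma sum_add_ne_zero (hV : finrank (ZMod 3) V = 4) (hC : ThreeAPFree (C : Set V)) (hn : #C = 20)
    {c : V} (hc : c ∈ C) : ∑ x ∈ C, x + c ≠ 0 := by
  classical
  intro hsum
  have : FiniteDimensional (ZMod 3) V := .of_finrank_pos (by lia)
  have : Finite (Dual (ZMod 3) V) := Module.finite_of_finite (ZMod 3)
  have := Fintype.ofFinite (Dual (ZMod 3) V)
  have h1 := sum_level (d := 2) (n := 19) hV hn hc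
  have h2 := sum_sum_level (d := 2) (n := 19) hV hn
  have h3 := sum_sum_level_sq (d := 2) (n := 18) hC hV hn
  rw [← add_sum_erase _ _ (mem_univ 0)] at h1 h2 h3
  simp_rw [level_zero_apply, sum_const, hn, smul_eq_mul] at h1 h2 h3
  have hcard := card_dual_ne_zero hV
  set S := (univ : Finset (Dual (ZMod 3) V)).erase 0
  have hS : ∀ u ∈ S, 18 * ∑ x ∈ C, level C u (u x) + 3 * level C u (u c) ≤
      ∑ x ∈ C, level C u (u x) ^ 2 + 1528 := by
    intro u hu
    have hsumu : ∑ x ∈ C, u x + u c = 0 := by rw [← map_sum, ← map_add, hsum, map_zero]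
    rw [show ∑ x ∈ C, u x = _ from sum_comp_apply C u id] at hsumu
    rw [sum_comp_apply, sum_comp_apply C u fun t ↦ level C u t ^ 2]
    refine level_pattern_le (level_le_nine hV hC (ne_of_mem_erase hu)) (by rw [level_add, hn]) ?_
    rw [← ZMod.natCast_eq_zero_iff, ← hsumu]
    simp [mul_comm]
  have := sum_le_sum hS
  rw [sum_add_distrib, sum_add_distrib, ← mul_sum, ← mul_sum, sum_const, hcard] at this
  simp at this h1 h2 h3
  lia

end Bounds
section Sequences

lemma exponent_eq_three : AddMonoid.exponent (Fin 4 → ZMod 3) = 3 :=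
  (AddMonoid.exponent_eq_prime_iff Nat.prime_three).2 fun g hg ↦
    addOrderOf_eq_prime (by ext i; simp [ZModModule.char_nsmul_eq_zero 3 (g i)]) hg

/-- A sequence of length 38 over `C₃⁴` without short zero-sum subsequences; its terms are the
nonzero points, each taken twice, of the cap `x₀² + x₁² + (x₂ - 1) x₃ = 0`, `x ≠ (0, 0, 1, 0)`. They
are ordered so that there are zero-sum cyclic windows of all lengths from 4 to 36. -/
def longSeq : List (Fin 4 → ZMod 3) :=
  [![2, 2, 0, 2], ![1, 2, 2, 1], ![1, 2, 0, 2], ![2, 1, 2, 1], ![2, 1, 0, 2], ![2, 0, 0, 1],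
    ![2, 1, 2, 1], ![0, 0, 1, 1], ![0, 1, 0, 1], ![0, 0, 1, 1], ![2, 2, 2, 1], ![1, 1, 0, 2],
    ![2, 0, 2, 2], ![1, 0, 0, 1], ![2, 0, 2, 2], ![1, 0, 0, 1], ![1, 1, 0, 2], ![1, 0, 2, 2],
    ![1, 1, 2, 1], ![1, 0, 2, 2], ![0, 2, 0, 1], ![2, 2, 2, 1], ![0, 2, 0, 1], ![0, 1, 2, 2],
    ![0, 0, 2, 0], ![0, 0, 2, 0], ![1, 2, 2, 1], ![1, 1, 2, 1], ![1, 2, 0, 2], ![0, 1, 2, 2],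
    ![0, 0, 1, 2], ![0, 0, 1, 2], ![2, 0, 0, 1], ![2, 2, 0, 2], ![2, 1, 0, 2], ![0, 1, 0, 1],
    ![0, 2, 2, 2], ![0, 2, 2, 2]]

/-- The entry of index `t` is the starting point of a zero-sum cyclic window of `longSeq` of length
`t + 4`. -/
def windowStart : List ℕ :=
  [17, 4, 10, 27, 22, 16, 12, 24, 25, 5, 12, 8, 31, 3, 12, 0, 13, 14, 30, 21, 24, 25, 26, 10, 35, 2,
    22, 27, 29, 33, 5, 25, 26]

lemma sum_window_eq_zero :
    ∀ t < 33, ((longSeq.rotate (windowStart.getD t 0)).take (t + 4)).sum = 0 := by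
  decide +kernel

/-- The points of the cap `x₀² + x₁² + (x₂ - 1) x₃ = 0`, `x ≠ (0, 0, 1, 0)` other than `0`. -/
def IsQuadricPoint (x : Fin 4 → ZMod 3) : Prop :=
  x 0 * x 0 + x 1 * x 1 + (x 2 - 1) * x 3 = 0 ∧ x ≠ 0 ∧ x ≠ ![0, 0, 1, 0]

instance : DecidablePred IsQuadricPoint := fun _ ↦ inferInstanceAs (Decidable (_ ∧ _))

lemma isQuadricPoint_of_mem_longSeq : ∀ a ∈ longSeq, IsQuadricPoint a := by
  decide +kernel

lemma eq_of_isQuadricPoint_neg_add : ∀ a ∈ longSeq.dedup, ∀ b ∈ longSeq.dedup,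
    a + b ≠ 0 ∧ (IsQuadricPoint (-(a + b)) → a = b) := by
  decide +kernel

lemma count_longSeq_le : ∀ a ∈ longSeq, longSeq.count a ≤ 2 := by
  decide +kernel

lemma three_nsmul_eq_zero (x : Fin 4 → ZMod 3) : 3 • x = 0 := by
  have := AddMonoid.exponent_nsmul_eq_zero x
  rwa [exponent_eq_three] at this

lemma not_hasShortZeroSumSubseq_longSeq :
    ¬ HasShortZeroSumSubseq (longSeq : Multiset (Fin 4 → ZMod 3)) := by
  rintro ⟨T, hT, hsum, h1, h3⟩
  rw [exponent_eq_three] at h3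
  have hmem {a : Fin 4 → ZMod 3} (ha : a ∈ T) : a ∈ longSeq := Multiset.subset_of_le hT ha
  have hpair {a b : Fin 4 → ZMod 3} (ha : a ∈ T) (hb : b ∈ T) :=
    eq_of_isQuadricPoint_neg_add a (List.mem_dedup.2 (hmem ha)) b (List.mem_dedup.2 (hmem hb))
  obtain h | h | h : T.card = 1 ∨ T.card = 2 ∨ T.card = 3 := by lia
  · obtain ⟨a, rfl⟩ := Multiset.card_eq_one.1 h
    exact (isQuadricPoint_of_mem_longSeq a (hmem (by simp))).2.1 (by simpa using hsum)
  · obtain ⟨a, b, rfl⟩ := Multiset.card_eq_two.1 h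
    exact (hpair (a := a) (b := b) (by simp) (by simp)).1 (by simpa using hsum)
  · obtain ⟨a, b, c, rfl⟩ := Multiset.card_eq_three.1 h
    have habc : a + b + c = 0 := by simpa [add_assoc] using hsum
    obtain rfl : a = b := (hpair (by simp) (by simp)).2 <| by
      rw [neg_eq_of_add_eq_zero_right habc]
      exact isQuadricPoint_of_mem_longSeq c (hmem (by simp))
    obtain rfl : a = c := (hpair (by simp) (by simp)).2 <| by
      rw [neg_eq_of_add_eq_zero_right ((add_right_comm a c a).trans habc)]
      exact isQuadricPoint_of_mem_longSeq a (hmem (by simp))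
    have := (Multiset.count_le_of_le a hT).trans
      ((Multiset.coe_count a longSeq).le.trans (count_longSeq_le a (hmem (by simp))))
    simp at this

lemma exists_zero_sum {t : ℕ} (h4 : 4 ≤ t) (h36 : t ≤ 36) :
    ∃ S : Multiset (Fin 4 → ZMod 3), S.card = t ∧ S.sum = 0 ∧ ¬ HasShortZeroSumSubseq S := by
  obtain ⟨s, rfl⟩ := Nat.exists_eq_add_of_le' h4
  set l := (longSeq.rotate (windowStart.getD s 0)).take (s + 4) with hl
  refine ⟨l, ?_, ?_, fun ⟨T, hT, h⟩ ↦ ?_⟩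
  · have : longSeq.length = 38 := rfl
    simp [hl]
    lia
  · rw [Multiset.sum_coe]
    exact sum_window_eq_zero s (by lia)
  · refine not_hasShortZeroSumSubseq_longSeq ⟨T, hT.trans ?_, h⟩
    rw [← Multiset.coe_eq_coe.2 (List.rotate_perm longSeq (windowStart.getD s 0))]
    exact (List.take_sublist _ _).subperm

lemma hasShortZeroSumSubseq_of_finset {S : Multiset (Fin 4 → ZMod 3)}
    {T : Finset (Fin 4 → ZMod 3)} (hT : ∀ x ∈ T, x ∈ S) (hne : T.Nonempty) (h3 : #T ≤ 3)
    (hsum : ∑ x ∈ T, x = 0) : HasShortZeroSumSubseq S :=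
  ⟨T.val, (Multiset.le_iff_subset T.nodup).2 hT, by simpa using hsum, hne.card_pos,
    by rwa [exponent_eq_three]⟩

lemma threeAPFree_insert_zero {S : Multiset (Fin 4 → ZMod 3)} (hS : ¬ HasShortZeroSumSubseq S) :
    ThreeAPFree ((insert 0 S.toFinset : Finset (Fin 4 → ZMod 3)) : Set (Fin 4 → ZMod 3)) := by
  intro a ha b hb c hc habc
  by_contra hab
  have h3 (x : Fin 4 → ZMod 3) : x + x + x = 0 := by
    rw [← three_nsmul_eq_zero x, succ_nsmul, two_nsmul]
  have hbc : b ≠ c := by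
    rintro rfl
    exact hab (add_right_cancel habc)
  have hac : a ≠ c := by
    rintro rfl
    refine hab ?_
    calc a = (a + a + a) - (a + a) := by abel
      _ = (b + b + b) - (b + b) := by rw [h3, h3, habc]
      _ = b := by abel
  have hmem (x : Fin 4 → ZMod 3) (hx : x ∈ ({a, b, c} : Finset _).erase 0) : x ∈ S := by
    obtain ⟨hx0, hx⟩ := mem_erase.1 hx
    have hx' : x ∈ insert 0 S.toFinset := by
      obtain rfl | rfl | rfl : x = a ∨ x = b ∨ x = c := by simpa using hx
      exacts [ha, hb, hc]
    simpa [hx0] using hx'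
  refine hS (hasShortZeroSumSubseq_of_finset hmem ?_ ((card_erase_le).trans card_le_three) ?_)
  · rw [← card_pos]
    have := pred_card_le_card_erase (s := {a, b, c}) (a := (0 : Fin 4 → ZMod 3))
    rw [card_eq_three.2 ⟨a, b, c, hab, hac, hbc, rfl⟩] at this
    lia
  · rw [sum_erase (f := fun x ↦ x) (a := (0 : Fin 4 → ZMod 3)) _ rfl,
      sum_insert (by simp [hab, hac]), sum_pair hbc, add_left_comm, habc, ← add_assoc, h3]

lemma zero_notMem {S : Multiset (Fin 4 → ZMod 3)} (hS : ¬ HasShortZeroSumSubseq S) : 0 ∉ S :=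
  fun h ↦ hS (hasShortZeroSumSubseq_of_finset (T := ({0} : Finset (Fin 4 → ZMod 3)))
    (by simpa using h) (by simp) (by simp) (by simp))

lemma le_two_nsmul_toFinset {S : Multiset (Fin 4 → ZMod 3)} (hS : ¬ HasShortZeroSumSubseq S) :
    S ≤ 2 • S.toFinset.val := by
  refine Multiset.le_iff_count.2 fun a ↦ ?_
  by_cases ha : a ∈ S
  · rw [Multiset.count_nsmul, Multiset.count_eq_one_of_mem S.toFinset.nodup (by simpa using ha)]
    by_contra! h
    refine hS ⟨.replicate 3 a, Multiset.le_count_iff_replicate_le.1 h, ?_, by simp,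
      by simp [exponent_eq_three]⟩
    rw [Multiset.sum_replicate, three_nsmul_eq_zero]
  · simp [ha]

lemma finrank_eq_four : finrank (ZMod 3) (Fin 4 → ZMod 3) = 4 := by simp

lemma card_toFinset_le {S : Multiset (Fin 4 → ZMod 3)} (hS : ¬ HasShortZeroSumSubseq S) :
    #S.toFinset ≤ 19 := by
  have := card_le_twenty finrank_eq_four (threeAPFree_insert_zero hS)
  rw [card_insert_of_notMem (by simpa using zero_notMem hS)] at this
  lia

lemma card_le_two_mul {S : Multiset (Fin 4 → ZMod 3)} (hS : ¬ HasShortZeroSumSubseq S) :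
    S.card ≤ 2 * #S.toFinset := by
  have := Multiset.card_le_card (le_two_nsmul_toFinset hS)
  rwa [Multiset.card_nsmul, card_val] at this

lemma hasShortZeroSumSubseq_of_sum_eq_zero {S : Multiset (Fin 4 → ZMod 3)} (hcard : 37 ≤ S.card)
    (hsum : S.sum = 0) : HasShortZeroSumSubseq S := by
  by_contra hS
  have h19 := card_toFinset_le hS
  have h2 := card_le_two_mul hS
  have hC : #(insert 0 S.toFinset) = 20 := by
    rw [card_insert_of_notMem (by simpa using zero_notMem hS)]
    lia
  have hne {c : Fin 4 → ZMod 3} (hc : c ∈ insert 0 S.toFinset) : ∑ x ∈ S.toFinset, x + c ≠ 0 := by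
    have := sum_add_ne_zero finrank_eq_four (threeAPFree_insert_zero hS) hC hc
    rwa [sum_insert (by simpa using zero_notMem hS), zero_add] at this
  obtain ⟨R, hR⟩ := Multiset.le_iff_exists_add.1 (le_two_nsmul_toFinset hS)
  have hRcard := congrArg Multiset.card hR
  have hRsum := congrArg Multiset.sum hR
  simp only [Multiset.card_nsmul, Multiset.card_add, card_val] at hRcard
  rw [Multiset.sum_nsmul, Multiset.sum_add, hsum, zero_add] at hRsum
  have hsum3 : ∑ x ∈ S.toFinset, x + R.sum = 0 := by
    rw [← hRsum, ← three_nsmul_eq_zero (∑ x ∈ S.toFinset, x), succ_nsmul' _ 2, sum_val]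
    rfl
  obtain h | h : R.card = 0 ∨ R.card = 1 := by lia
  · rw [Multiset.card_eq_zero.1 h] at hsum3
    exact hne (mem_insert_self _ _) hsum3
  · obtain ⟨c, rfl⟩ := Multiset.card_eq_one.1 h
    rw [Multiset.sum_singleton] at hsum3
    refine hne (mem_insert_of_mem ?_) hsum3
    have : c ∈ 2 • S.toFinset.val := hR ▸ by simp
    simpa using Multiset.mem_of_mem_nsmul this

lemma etaConst_eq : etaConst (Fin 4 → ZMod 3) = 39 := by
  have h39 : 39 ∈ {d : ℕ | ∀ S : Multiset (Fin 4 → ZMod 3), d ≤ S.card →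
      HasShortZeroSumSubseq S} := by
    intro S hcard
    by_contra hS
    have := card_toFinset_le hS
    have := card_le_two_mul hS
    lia
  refine le_antisymm (Nat.sInf_le h39) (le_csInf ⟨39, h39⟩ fun d hd ↦ ?_)
  by_contra! hlt
  refine not_hasShortZeroSumSubseq_longSeq (hd _ ?_)
  have : longSeq.length = 38 := rfl
  rw [Multiset.coe_card]
  lia

lemma exists_ne_of_three_dvd_card {α : Type*} {_ : Fintype α} (h : 3 ∣ Fintype.card α) (a : α) :
    ∃ b, b ≠ a := by
  have := Nat.le_of_dvd (Fintype.card_pos_iff.2 ⟨a⟩) h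
  exact Fintype.exists_ne_of_one_lt_card (by lia) a

lemma exists_ne_zero_sum_sq_mul_eq_zero {n : ℕ} (hn : 9 ≤ n) (g : Fin n → Fin 4 → ZMod 3) :
    ∃ x : Fin n → ZMod 3, x ≠ 0 ∧ ∀ j, ∑ i, g i j * x i ^ 2 = 0 := by
  let f (j : Fin 4) : MvPolynomial (Fin n) (ZMod 3) :=
    ∑ i, MvPolynomial.C (g i j) * MvPolynomial.X i ^ 2
  have hdeg (j : Fin 4) : (f j).totalDegree ≤ 2 := by
    refine MvPolynomial.totalDegree_finsetSum_le fun i _ ↦ ?_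
    refine (MvPolynomial.totalDegree_mul _ _).trans ?_
    rw [MvPolynomial.totalDegree_C, MvPolynomial.totalDegree_X_pow]
  have hlt : ∑ j, (f j).totalDegree < Fintype.card (Fin n) := by
    rw [Fintype.card_fin]
    refine (sum_le_card_nsmul _ _ 2 fun j _ ↦ hdeg j).trans_lt ?_
    rw [card_univ, Fintype.card_fin, smul_eq_mul]
    lia
  have hdvd := char_dvd_card_solutions_of_fintype_sum_lt 3 hlt
  have heval (x : Fin n → ZMod 3) (j : Fin 4) :
      MvPolynomial.eval x (f j) = ∑ i, g i j * x i ^ 2 := by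
    simp only [f, map_sum, map_mul, map_pow, MvPolynomial.eval_C, MvPolynomial.eval_X]
  have h0 (j : Fin 4) : MvPolynomial.eval (0 : Fin n → ZMod 3) (f j) = 0 := by
    rw [heval]
    exact sum_eq_zero fun i _ ↦ by rw [Pi.zero_apply, zero_pow two_ne_zero, mul_zero]
  obtain ⟨⟨x, hx⟩, hx0⟩ := exists_ne_of_three_dvd_card hdvd ⟨0, h0⟩
  exact ⟨x, fun h ↦ hx0 (Subtype.ext h), fun j ↦ heval x j ▸ hx j⟩

lemma exists_nonempty_sum_eq_zero {n : ℕ} (hn : 9 ≤ n) (g : Fin n → Fin 4 → ZMod 3) :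
    ∃ I : Finset (Fin n), I.Nonempty ∧ ∑ i ∈ I, g i = 0 := by
  obtain ⟨x, hx0, hx⟩ := exists_ne_zero_sum_sq_mul_eq_zero hn g
  obtain ⟨i, hi⟩ := Function.ne_iff.1 hx0
  refine ⟨univ.filter fun i ↦ x i ≠ 0, ⟨i, by simpa using hi⟩, funext fun j ↦ ?_⟩
  have hsq : ∀ y : ZMod 3, y ^ 2 = if y ≠ 0 then 1 else 0 := by decide
  rw [Finset.sum_apply, sum_filter]
  refine Eq.trans ?_ (hx j)
  exact sum_congr rfl fun i _ ↦ by rw [hsq, mul_ite, mul_one, mul_zero]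

/-- The upper bound for the Davenport constant, from the Chevalley–Warning theorem. -/
lemma exists_zero_sum_of_nine_le (S : Multiset (Fin 4 → ZMod 3)) (hS : 9 ≤ S.card) :
    ∃ T, T ≤ S ∧ T ≠ 0 ∧ T.sum = 0 := by
  obtain ⟨l, rfl⟩ := Quot.exists_rep S
  obtain ⟨I, hI, hsum⟩ := exists_nonempty_sum_eq_zero (n := l.length) hS l.get
  refine ⟨I.val.map l.get, ?_, ?_, hsum⟩
  · refine (Multiset.map_le_map (val_le_iff.2 (subset_univ I))).trans_eq ?_
    rw [Fin.univ_val_map, List.ofFn_get]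
    rfl
  · rw [Ne, Multiset.map_eq_zero, val_eq_zero]
    exact hI.ne_empty

lemma davenport_le : davenport (Fin 4 → ZMod 3) ≤ 9 :=
  Nat.sInf_le exists_zero_sum_of_nine_le

lemma three_le_davenport : 3 ≤ davenport (Fin 4 → ZMod 3) := by
  refine le_csInf ⟨9, exists_zero_sum_of_nine_le⟩ fun d hd ↦ ?_
  by_contra! hlt
  obtain ⟨T, hT, hT0, hsum⟩ := hd {![1, 0, 0, 0], ![0, 1, 0, 0]} (by simpa using by lia)
  have key : ∀ T ∈ ({![1, 0, 0, 0], ![0, 1, 0, 0]} : Multiset (Fin 4 → ZMod 3)).powerset,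
      T ≠ 0 → T.sum ≠ 0 := by
    decide
  exact key T (Multiset.mem_powerset.2 hT) hT0 hsum

end Sequences

end CapSet

theorem stmt_9 : C0 (Fin 4 → ZMod 3) = {37, 38} := by
  have hdav := CapSet.davenport_le
  have hdav' := CapSet.three_le_davenport
  ext t
  simp only [C0, CapSet.etaConst_eq, Set.mem_ofPred_eq, Set.mem_insert_iff, Set.mem_singleton_iff]
  constructor
  · rintro ⟨h1, h2, h⟩
    by_contra ht
    obtain ⟨S, hcard, hsum, hS⟩ := CapSet.exists_zero_sum (t := t) (by lia) (by lia)
    exact hS (h S hcard hsum)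
  · intro ht
    exact ⟨by lia, by lia, fun S hcard hsum ↦
      CapSet.hasShortZeroSumSubseq_of_sum_eq_zero (by lia) hsum⟩
end

section
/- Let G = C_n^r with n ≥ 3 and r ≥ 3, and let α_r ∈ [0, n-1] be the residue of -2^{r-1} modulo n. If α_r = 0 (equivalently, n = 2^k for some k ≤ r - 1), then C_0(G) is contained in the two-element set {(2^r - 1)(n - 1) - n, (2^r - 1)(n - 1) - n + 1}. -/
theorem Multiset.exists_le_map_eq_of_le_map {α β : Type*} {f : α → β} {T : Multiset β}
    {S : Multiset α} (h : T ≤ S.map f) : ∃ V ≤ S, V.map f = T := by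
  classical
  induction S using Multiset.induction_on generalizing T with
  | empty => exact ⟨0, le_rfl, by simpa [eq_comm] using h⟩
  | cons a S ih =>
    rw [Multiset.map_cons] at h
    by_cases ha : f a ∈ T
    · obtain ⟨T', rfl⟩ := Multiset.exists_cons_of_mem ha
      obtain ⟨V, hV, rfl⟩ := ih ((Multiset.cons_le_cons_iff _).1 h)
      exact ⟨a ::ₘ V, Multiset.cons_le_cons _ hV, Multiset.map_cons _ _ _⟩
    · obtain ⟨V, hV, rfl⟩ := ih ((Multiset.le_cons_of_notMem ha).1 h)
      exact ⟨V, hV.trans (Multiset.le_cons_self _ _), rfl⟩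

theorem exponent_pi_zmod (n r : ℕ) (hr : 0 < r) :
    AddMonoid.exponent (Fin r → ZMod n) = n := by
  apply Nat.dvd_antisymm
  · refine AddMonoid.exponent_dvd_of_forall_nsmul_eq_zero fun x => ?_
    ext i
    simp
  · have h := AddMonoid.exponent_nsmul_eq_zero (fun _ : Fin r => (1 : ZMod n))
    have h0 := congrFun h ⟨0, hr⟩
    simpa [ZMod.natCast_eq_zero_iff] using h0

section UpperBound

/-- Pairs of vectors congruent modulo `2`, and even vectors, can be split off as long as
at least `2 ^ r` terms remain. -/
theorem exists_even_blocks {r : ℕ} (q : ℕ) (S : Multiset (Fin r → ℤ))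
    (hS : 2 * q + 2 ^ r ≤ Multiset.card S + 2) :
    ∃ P : Multiset (Multiset (Fin r → ℤ)), Multiset.card P = q ∧ P.join ≤ S ∧
      ∀ B ∈ P, B ≠ 0 ∧ Multiset.card B ≤ 2 ∧ ∀ i, (2 : ℤ) ∣ B.sum i := by
  classical
  induction q generalizing S with
  | zero => exact ⟨0, rfl, by simp, by simp⟩
  | succ q ih =>
    have hblock : ∃ B ≤ S, B ≠ 0 ∧ Multiset.card B ≤ 2 ∧ ∀ i, (2 : ℤ) ∣ B.sum i := by
      let g : (Fin r → ℤ) → (Fin r → ZMod 2) := fun x i => (x i : ZMod 2)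
      have hnd : ¬ (S.map g).Nodup ∨ 0 ∈ S.map g := by
        by_contra! h
        have hcard : Multiset.card (0 ::ₘ S.map g) ≤ 2 ^ r := by
          have h' : (0 ::ₘ S.map g).Nodup := Multiset.nodup_cons.2 ⟨h.2, h.1⟩
          have := Finset.card_le_univ (⟨_, h'⟩ : Finset (Fin r → ZMod 2))
          rw [Finset.card_mk] at this
          simpa only [Finset.card_univ, Fintype.card_pi, ZMod.card, Finset.prod_const,
            Fintype.card_fin] using this
        simp only [Multiset.card_cons, Multiset.card_map] at hcard
        omega
      rcases hnd with h | h
      · simp only [Multiset.nodup_iff_le, not_forall, not_not] at h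
        obtain ⟨y, hy⟩ := h
        obtain ⟨B, hB, hBy⟩ := Multiset.exists_le_map_eq_of_le_map hy
        have hc : Multiset.card B = 2 := by
          rw [← Multiset.card_map g, hBy]; rfl
        have hBy' : ∀ z ∈ B.map g, z = y := fun z hz => by
          rw [hBy] at hz
          simpa using hz
        obtain ⟨a, b, rfl⟩ := Multiset.card_eq_two.1 hc
        refine ⟨_, hB, by simp, hc.le, fun i => ?_⟩
        have ha : g a = y := hBy' _ (Multiset.mem_map_of_mem g (by simp))
        have hb : g b = y := hBy' _ (Multiset.mem_map_of_mem g (by simp))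
        have hab := congrFun (ha.trans hb.symm) i
        have h2 := (ZMod.intCast_eq_intCast_iff_dvd_sub (a i) (b i) 2).1 hab
        simp only [Multiset.insert_eq_cons, Multiset.sum_cons, Multiset.sum_singleton,
          Pi.add_apply]
        push_cast at h2
        omega
      · obtain ⟨a, ha, ha0⟩ := Multiset.mem_map.1 h
        refine ⟨{a}, Multiset.singleton_le.2 ha, by simp, by simp, fun i => ?_⟩
        have := (ZMod.intCast_zmod_eq_zero_iff_dvd (a i) 2).1 (congrFun ha0 i)
        simpa using this
    obtain ⟨B, hBS, hB⟩ := hblock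
    obtain ⟨P, hP, hPS, hPB⟩ := ih (S - B) (by
      rw [Multiset.card_sub hBS]
      have := hB.2.1
      omega)
    refine ⟨B ::ₘ P, by simp [hP], ?_, ?_⟩
    · rw [Multiset.join_cons]
      calc B + P.join ≤ B + (S - B) := by gcongr
        _ = S := add_tsub_cancel_of_le hBS
    · intro C hC
      rcases Multiset.mem_cons.1 hC with rfl | hC
      · exact hB
      · exact hPB C hC

theorem exists_short_zeroSum_int {r : ℕ} (k : ℕ) (S : Multiset (Fin r → ℤ))
    (hS : (2 ^ r - 1) * (2 ^ k - 1) + 1 ≤ Multiset.card S) :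
    ∃ T ≤ S, T ≠ 0 ∧ Multiset.card T ≤ 2 ^ k ∧ ∀ i, (2 ^ k : ℤ) ∣ T.sum i := by
  induction k generalizing S with
  | zero =>
    obtain ⟨a, ha⟩ := Multiset.card_pos_iff_exists_mem.1 (show 0 < Multiset.card S by omega)
    exact ⟨{a}, Multiset.singleton_le.2 ha, by simp, by simp, by simp⟩
  | succ k ih =>
    obtain ⟨P, hPc, hPS, hP⟩ := exists_even_blocks ((2 ^ r - 1) * (2 ^ k - 1) + 1) S (by
      obtain ⟨a, ha⟩ : ∃ a, 2 ^ r = a + 1 :=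
        ⟨2 ^ r - 1, by have := Nat.one_le_two_pow (n := r); omega⟩
      obtain ⟨b, hb⟩ : ∃ b, 2 ^ k = b + 1 :=
        ⟨2 ^ k - 1, by have := Nat.one_le_two_pow (n := k); omega⟩
      have hb' : 2 ^ (k + 1) - 1 = 2 * b + 1 := by rw [pow_succ]; omega
      rw [hb', ha] at hS
      rw [ha, hb]
      simp only [Nat.add_sub_cancel] at *
      linarith)
    obtain ⟨T', hT', hT0, hTc, hTs⟩ := ih (P.map fun B i => B.sum i / 2) (by simp [hPc])
    obtain ⟨Q, hQP, rfl⟩ := Multiset.exists_le_map_eq_of_le_map hT'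
    have hQ : ∀ B ∈ Q, B ≠ 0 ∧ Multiset.card B ≤ 2 ∧ ∀ i, (2 : ℤ) ∣ B.sum i :=
      fun B hB => hP B (Multiset.mem_of_le hQP hB)
    obtain ⟨R, rfl⟩ := Multiset.le_iff_exists_add.1 hQP
    refine ⟨Q.join, le_trans ?_ hPS, ?_, ?_, fun i => ?_⟩
    · rw [Multiset.join_add]; exact Multiset.le_add_right _ _
    · obtain ⟨B, hB⟩ := Multiset.exists_mem_of_ne_zero
        (show Q ≠ 0 by rintro rfl; simp at hT0)
      obtain ⟨x, hx⟩ := Multiset.exists_mem_of_ne_zero (hQ B hB).1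
      intro h
      have : x ∈ Q.join := Multiset.mem_join.2 ⟨B, hB, hx⟩
      simp [h] at this
    · rw [Multiset.card_join]
      have := Multiset.sum_le_card_nsmul (Q.map Multiset.card) 2 (by
        intro x hx
        obtain ⟨B, hB, rfl⟩ := Multiset.mem_map.1 hx
        exact (hQ B hB).2.1)
      simp only [Multiset.card_map, smul_eq_mul] at this hTc
      rw [pow_succ]
      omega
    · have hsum : Q.join.sum i =
          2 * (Q.map fun (B : Multiset (Fin r → ℤ)) i => B.sum i / 2).sum i := by
        clear hTs hTc hT0 hT' hQP hPS hP hPc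
        induction Q using Multiset.induction_on with
        | empty => simp
        | cons B Q ih =>
          have hB := (hQ B (Multiset.mem_cons_self _ _)).2.2 i
          have h := ih fun C hC => hQ C (Multiset.mem_cons_of_mem hC)
          simp only [Multiset.join_cons, Multiset.sum_add, Pi.add_apply, Multiset.map_cons,
            Multiset.sum_cons, h]
          omega
      rw [hsum, pow_succ, mul_comm]
      exact mul_dvd_mul_left 2 (hTs i)

theorem hasShortZeroSumSubseq_of_card {k r : ℕ} (hr : 0 < r) (S : Multiset (Fin r → ZMod (2 ^ k)))
    (hS : (2 ^ r - 1) * (2 ^ k - 1) + 1 ≤ Multiset.card S) : HasShortZeroSumSubseq S := by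
  let lift : (Fin r → ZMod (2 ^ k)) → (Fin r → ℤ) := fun x i => ((x i).val : ℤ)
  let proj : (Fin r → ℤ) →+ (Fin r → ZMod (2 ^ k)) :=
    (Int.castAddHom (ZMod (2 ^ k))).compLeft (Fin r)
  have hproj : (S.map lift).map proj = S := by
    rw [Multiset.map_map]
    conv_rhs => rw [← Multiset.map_id S]
    refine Multiset.map_congr rfl fun x _ => ?_
    ext i
    simp [proj, lift]
  obtain ⟨T, hTS, hT0, hTc, hTs⟩ := exists_short_zeroSum_int k (S.map lift) (by simpa using hS)
  refine ⟨T.map proj, hproj ▸ Multiset.map_le_map hTS, ?_, ?_, ?_⟩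
  · rw [← map_multiset_sum]
    ext i
    have := (ZMod.intCast_zmod_eq_zero_iff_dvd (T.sum i) (2 ^ k)).2 (by exact_mod_cast hTs i)
    simpa [proj] using this
  · simpa [Nat.one_le_iff_ne_zero] using hT0
  · rw [exponent_pi_zmod _ _ hr]
    simpa using hTc

end UpperBound

section Layers

/-- The vector whose first coordinate is `p.1` and whose other coordinates are the indicator
function of `p.2`. -/
def layerVec (n : ℕ) {m : ℕ} (p : ℕ × Finset (Fin m)) : Fin (m + 1) → ZMod n :=
  Fin.cons (p.1 : ZMod n) fun i => if i ∈ p.2 then 1 else 0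

theorem sum_map_layerVec_zero {n m : ℕ} (U : Multiset (ℕ × Finset (Fin m))) :
    (U.map (layerVec n)).sum 0 = ((U.map Prod.fst).sum : ZMod n) := by
  induction U using Multiset.induction_on with
  | empty => simp
  | cons p U ih => simp [ih, layerVec]

theorem sum_map_layerVec_succ {n m : ℕ} (U : Multiset (ℕ × Finset (Fin m))) (i : Fin m) :
    (U.map (layerVec n)).sum i.succ = (Multiset.card (U.filter fun p => i ∈ p.2) : ZMod n) := by
  induction U using Multiset.induction_on with
  | empty => simp
  | cons p U ih =>
    by_cases h : i ∈ p.2 <;> simp [ih, layerVec, h, add_comm]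

theorem not_hasShortZeroSumSubseq_layerVec {n m : ℕ} (hn : 0 < n)
    (U : Multiset (ℕ × Finset (Fin m)))
    (hsum : ∀ J, ((U.filter fun p => p.2 = J).map Prod.fst).sum ≤ n - 1)
    (hzero : ∀ J, U.count (0, J) ≤ n - 1) (hempty : (0, ∅) ∉ U) :
    ¬ HasShortZeroSumSubseq (U.map (layerVec n)) := by
  rintro ⟨T, hT, hT0, hT1, hTn⟩
  rw [exponent_pi_zmod _ _ (Nat.succ_pos m)] at hTn
  obtain ⟨V, hVU, rfl⟩ := Multiset.exists_le_map_eq_of_le_map hT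
  rw [Multiset.card_map] at hT1 hTn
  have hdvd : ∀ i, n ∣ Multiset.card (V.filter fun p => i ∈ p.2) := fun i => by
    rw [← ZMod.natCast_eq_zero_iff, ← sum_map_layerVec_succ, hT0, Pi.zero_apply]
  have hle : ∀ i : Fin m, Multiset.card (V.filter fun p => i ∈ p.2) ≤ Multiset.card V :=
    fun i => Multiset.card_le_card (Multiset.filter_le _ _)
  have hall : ∀ i : Fin m, (∃ p ∈ V, i ∈ p.2) → Multiset.card V = n ∧ ∀ p ∈ V, i ∈ p.2 := by
    rintro i ⟨p, hp, hip⟩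
    have hpos : 0 < Multiset.card (V.filter fun p => i ∈ p.2) :=
      Multiset.card_pos_iff_exists_mem.2 ⟨p, Multiset.mem_filter.2 ⟨hp, hip⟩⟩
    have := Nat.le_of_dvd hpos (hdvd i)
    have := hle i
    refine ⟨by omega, Multiset.filter_eq_self.1 ?_⟩
    exact Multiset.eq_of_le_of_card_le (Multiset.filter_le _ _) (by omega)
  obtain ⟨p₀, hp₀⟩ := Multiset.card_pos_iff_exists_mem.1 (show 0 < Multiset.card V by omega)
  have hJ : ∀ p ∈ V, p.2 = p₀.2 := fun p hp => by
    ext i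
    exact ⟨fun h => (hall i ⟨p, hp, h⟩).2 p₀ hp₀, fun h => (hall i ⟨p₀, hp₀, h⟩).2 p hp⟩
  have hVle : V ≤ U.filter fun p => p.2 = p₀.2 := Multiset.le_filter.2 ⟨hVU, hJ⟩
  have hVsum : (V.map Prod.fst).sum = 0 := by
    have hlt : (V.map Prod.fst).sum ≤ n - 1 := by
      refine le_trans ?_ (hsum p₀.2)
      obtain ⟨W, hW⟩ := Multiset.le_iff_exists_add.1 hVle
      rw [hW, Multiset.map_add, Multiset.sum_add]
      exact Nat.le_add_right _ _
    refine Nat.eq_zero_of_dvd_of_lt ?_ (show _ < n by omega)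
    rw [← ZMod.natCast_eq_zero_iff, ← sum_map_layerVec_zero, hT0, Pi.zero_apply]
  have hVrep : V = Multiset.replicate (Multiset.card V) (0, p₀.2) := by
    refine Multiset.eq_replicate.2 ⟨rfl, fun p hp => Prod.ext ?_ (hJ p hp)⟩
    exact Multiset.sum_eq_zero_iff.1 hVsum _ (Multiset.mem_map_of_mem _ hp)
  have hp₀V : (0, p₀.2) ∈ V := by
    rw [hVrep]; exact Multiset.mem_replicate.2 ⟨by omega, rfl⟩
  have hcount : Multiset.card V ≤ U.count (0, p₀.2) :=
    Multiset.le_count_iff_replicate_le.2 (hVrep ▸ hVU)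
  rcases p₀.2.eq_empty_or_nonempty with h | ⟨i, hi⟩
  · exact hempty (h ▸ Multiset.mem_of_le hVU hp₀V)
  · have := (hall i ⟨p₀, hp₀, hi⟩).1
    have := hzero p₀.2
    omega

end Layers

theorem etaConst_le {k r : ℕ} (hr : 0 < r) :
    etaConst (Fin r → ZMod (2 ^ k)) ≤ (2 ^ r - 1) * (2 ^ k - 1) + 1 :=
  Nat.sInf_le fun S hS => hasShortZeroSumSubseq_of_card hr S hS

theorem lt_davenport {k m : ℕ} (hk : 0 < k) (hm : 0 < m) :
    2 ^ k < davenport (Fin (m + 1) → ZMod (2 ^ k)) := by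
  have hn : 2 ≤ 2 ^ k := Nat.le_self_pow hk.ne' 2
  have hmem := Nat.sInf_mem (s := {d : ℕ | ∀ S : Multiset (Fin (m + 1) → ZMod (2 ^ k)),
      d ≤ Multiset.card S → ∃ T, T ≤ S ∧ T ≠ 0 ∧ T.sum = 0})
    ⟨(2 ^ (m + 1) - 1) * (2 ^ k - 1) + 1, fun S hS => by
      obtain ⟨T, hTS, hT0, hT1, -⟩ := hasShortZeroSumSubseq_of_card m.succ_pos S hS
      exact ⟨T, hTS, by rintro rfl; simp at hT1, hT0⟩⟩
  by_contra! hle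
  let J : Finset (Fin m) := {⟨0, hm⟩}
  have hJ : J ≠ ∅ := Finset.singleton_ne_empty _
  let U : Multiset (ℕ × Finset (Fin m)) := (1, J) ::ₘ Multiset.replicate (2 ^ k - 1) (1, ∅)
  have hU : Multiset.card (U.map (layerVec (2 ^ k))) = 2 ^ k := by
    simp only [U, Multiset.card_map, Multiset.card_cons, Multiset.card_replicate]
    omega
  obtain ⟨T, hTS, hT0, hTs⟩ := hmem (U.map (layerVec (2 ^ k))) (hle.trans hU.ge)
  refine not_hasShortZeroSumSubseq_layerVec (n := 2 ^ k) (by omega) U ?_ ?_ ?_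
    ⟨T, hTS, hTs, by simpa [Nat.one_le_iff_ne_zero] using hT0, ?_⟩
  · intro J'
    have hf : (Multiset.replicate (2 ^ k - 1) ((1, ∅) : ℕ × Finset (Fin m))).filter
        (fun p => p.2 = J') = if ∅ = J' then Multiset.replicate (2 ^ k - 1) (1, ∅) else 0 := by
      split_ifs with h
      · exact Multiset.filter_eq_self.2 fun p hp => by rw [Multiset.eq_of_mem_replicate hp, h]
      · exact Multiset.filter_eq_nil.2 fun p hp => by rwa [Multiset.eq_of_mem_replicate hp]
    simp only [U, Multiset.filter_cons, hf]
    by_cases h : ∅ = J'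
    · subst h
      simp [hJ]
    · by_cases h' : J = J'
      · simp [h, h']
        omega
      · simp [h, h']
  · intro J'
    have : U.count (0, J') = 0 := by simp [U, Multiset.mem_replicate]
    omega
  · simp [U, Multiset.mem_replicate]
  · rw [exponent_pi_zmod _ _ m.succ_pos]
    exact (Multiset.card_le_card hTS).trans hU.le

section Construction

theorem exists_multiset_nat (l c : ℕ) (h : l = 0 → c = 0) :
    ∃ M : Multiset ℕ, Multiset.card M = l ∧ M.sum = c ∧ M.count 0 ≤ l - c := by
  rcases Nat.eq_zero_or_pos l with rfl | hl
  · exact ⟨0, by simp [h rfl]⟩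
  rcases le_or_gt l c with hlc | hlc
  · refine ⟨(c - l + 1) ::ₘ Multiset.replicate (l - 1) 1, ?_, ?_, ?_⟩
    · simp; omega
    · simp; omega
    · simp [Multiset.count_replicate]
  · refine ⟨Multiset.replicate c 1 + Multiset.replicate (l - c) 0, ?_, ?_, ?_⟩
    · simp; omega
    · simp
    · simp [Multiset.count_replicate]

theorem exists_zeroSum_of_layers {n m : ℕ} (hn : 0 < n) (l c : Finset (Fin m) → ℕ)
    (hlc : ∀ J, l J = 0 → c J = 0) (hc : ∀ J, c J ≤ n - 1) (hl : ∀ J, l J ≤ c J + (n - 1))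
    (hempty : l ∅ ≤ c ∅) (hcsum : ∑ J, (c J : ZMod n) = 0)
    (hlsum : ∀ i, ∑ J, (if i ∈ J then (l J : ZMod n) else 0) = 0) :
    ∃ S : Multiset (Fin (m + 1) → ZMod n), Multiset.card S = ∑ J, l J ∧ S.sum = 0 ∧
      ¬ HasShortZeroSumSubseq S := by
  choose M hMc hMs hM0 using fun J => exists_multiset_nat (l J) (c J) (hlc J)
  let U : Multiset (ℕ × Finset (Fin m)) := ∑ J, (M J).map fun x => (x, J)
  have hfilter : ∀ J, U.filter (fun p => p.2 = J) = (M J).map fun x => (x, J) := by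
    intro J
    have : U.filter (fun p => p.2 = J) =
        ∑ J', ((M J').map fun x => (x, J')).filter fun p => p.2 = J :=
      map_sum (⟨⟨Multiset.filter _, Multiset.filter_zero _⟩, Multiset.filter_add _⟩ :
        Multiset (ℕ × Finset (Fin m)) →+ Multiset (ℕ × Finset (Fin m))) _ _
    rw [this, Finset.sum_eq_single J]
    · exact Multiset.filter_eq_self.2 (by simp)
    · intro J' _ hJ'
      exact Multiset.filter_eq_nil.2 (by simp [hJ'])
    · simp
  have hcount : ∀ J, U.count (0, J) = (M J).count 0 := by
    intro J
    rw [← Multiset.count_filter_of_pos (p := fun p => p.2 = J) rfl, hfilter]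
    exact Multiset.count_map_eq_count' (fun x => (x, J)) _ (Prod.mk_left_injective J) 0
  refine ⟨U.map (layerVec n), ?_, ?_, not_hasShortZeroSumSubseq_layerVec hn U ?_ ?_ ?_⟩
  · simp [U, hMc]
  · ext i
    refine Fin.cases ?_ (fun i => ?_) i
    · have : (U.map Prod.fst).sum = ∑ J, c J := by
        simp only [U, ← Multiset.coe_mapAddMonoidHom, ← Multiset.coe_sumAddMonoidHom, map_sum]
        simp [hMs]
      rw [sum_map_layerVec_zero, this, Nat.cast_sum, hcsum, Pi.zero_apply]
    · have : Multiset.card (U.filter fun p => i ∈ p.2) = ∑ J, if i ∈ J then l J else 0 := by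
        rw [← Multiset.countP_eq_card_filter]
        have : U.countP (fun p => i ∈ p.2) =
            ∑ J, ((M J).map fun x => (x, J)).countP fun p => i ∈ p.2 :=
          map_sum (Multiset.countPAddMonoidHom fun p : ℕ × Finset (Fin m) => i ∈ p.2) _ _
        rw [this]
        refine Finset.sum_congr rfl fun J _ => ?_
        by_cases h : i ∈ J <;> simp [Multiset.countP_map, h, hMc]
      rw [sum_map_layerVec_succ, this, Pi.zero_apply, ← hlsum i]
      push_cast
      rfl
  · intro J
    rw [hfilter, Multiset.map_map]
    simpa [hMs] using hc J
  · intro J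
    rw [hcount]
    have := hM0 J
    have := hl J
    omega
  · rw [← Multiset.count_eq_zero, hcount]
    have := hM0 ∅
    omega

theorem two_mul_card_filter_mem {m : ℕ} (i : Fin m) :
    2 * (Finset.univ.filter fun J : Finset (Fin m) => i ∈ J).card = 2 ^ m := by
  have h : (Finset.univ.filter fun J : Finset (Fin m) => i ∈ J).card =
      (Finset.univ.filter fun J : Finset (Fin m) => i ∉ J).card :=
    Finset.card_bij (fun J _ => Jᶜ) (by simp) (fun _ _ _ _ h => compl_injective h)
      fun J hJ => ⟨Jᶜ, by simpa using hJ, by simp⟩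
  have h' := Finset.card_filter_add_card_filter_not (s := Finset.univ)
    fun J : Finset (Fin m) => i ∈ J
  simp only [Finset.card_univ, Fintype.card_finset, Fintype.card_fin] at h'
  omega

/-- The function on subsets of `Fin m` that takes prescribed values on `∅`, `{i₀}`, `{i₁}`,
`{i₀, i₁}`, the value `x` on the other members of `K` and `y` elsewhere. -/
def stepFun {m : ℕ} (i₀ i₁ : Fin m) (K : Finset (Finset (Fin m))) (v₀ va vb vab x y : ℕ)
    (J : Finset (Fin m)) : ℕ :=
  if J = ∅ then v₀ else if J = {i₀} then va else if J = {i₁} then vb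
  else if J = {i₀, i₁} then vab else if J ∈ K then x else y

/-- The subsets of `Fin m` other than `∅`, `{i₀}`, `{i₁}` and `{i₀, i₁}`. -/
def otherSets {m : ℕ} (i₀ i₁ : Fin m) : Finset (Finset (Fin m)) :=
  Finset.univ \ {∅, {i₀}, {i₁}, {i₀, i₁}}

variable {m : ℕ} {i₀ i₁ : Fin m}

theorem pair_ne_singletons (h : i₀ ≠ i₁) :
    ({i₀} : Finset (Fin m)) ≠ {i₁} ∧ ({i₀} : Finset (Fin m)) ≠ {i₀, i₁} ∧
      ({i₁} : Finset (Fin m)) ≠ {i₀, i₁} := by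
  refine ⟨by simpa using h, fun e => ?_, fun e => ?_⟩
  · have : i₁ ∈ ({i₀} : Finset (Fin m)) := e ▸ by simp
    exact h (Finset.mem_singleton.1 this).symm
  · have : i₀ ∈ ({i₁} : Finset (Fin m)) := e ▸ by simp
    exact h (Finset.mem_singleton.1 this)

theorem sum_eq_add_sum_otherSets {R : Type*} [AddCommMonoid R] (h : i₀ ≠ i₁)
    (g : Finset (Fin m) → R) :
    ∑ J, g J = g ∅ + (g {i₀} + (g {i₁} + g {i₀, i₁})) + ∑ J ∈ otherSets i₀ i₁, g J := by
  obtain ⟨h1, h2, h3⟩ := pair_ne_singletons h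
  rw [otherSets, ← Finset.sum_sdiff (Finset.subset_univ {∅, {i₀}, {i₁}, {i₀, i₁}}), add_comm,
    Finset.sum_insert (by simp [eq_comm (a := (∅ : Finset (Fin m)))]),
    Finset.sum_insert (by simp [h1, h2]), Finset.sum_insert (by simp [h3]),
    Finset.sum_singleton]

theorem card_otherSets (h : i₀ ≠ i₁) : (otherSets i₀ i₁).card + 4 = 2 ^ m := by
  have := sum_eq_add_sum_otherSets h fun _ => 1
  simp at this
  omega

section StepFun

variable (K : Finset (Finset (Fin m))) (v₀ va vb vab x y : ℕ)

theorem stepFun_empty : stepFun i₀ i₁ K v₀ va vb vab x y ∅ = v₀ := by simp [stepFun]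

theorem stepFun_left : stepFun i₀ i₁ K v₀ va vb vab x y {i₀} = va := by simp [stepFun]

theorem stepFun_right (h : i₀ ≠ i₁) : stepFun i₀ i₁ K v₀ va vb vab x y {i₁} = vb := by
  simp [stepFun, h.symm]

theorem stepFun_pair (h : i₀ ≠ i₁) : stepFun i₀ i₁ K v₀ va vb vab x y {i₀, i₁} = vab := by
  obtain ⟨-, h2, h3⟩ := pair_ne_singletons h
  simp [stepFun, h2.symm, h3.symm]

theorem stepFun_other {J : Finset (Fin m)} (hJ : J ∈ otherSets i₀ i₁) :
    stepFun i₀ i₁ K v₀ va vb vab x y J = if J ∈ K then x else y := by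
  simp only [otherSets, Finset.mem_sdiff, Finset.mem_univ, true_and, Finset.mem_insert,
    Finset.mem_singleton, not_or] at hJ
  simp [stepFun, hJ]

theorem sum_stepFun (h : i₀ ≠ i₁) (hK : K ⊆ otherSets i₀ i₁) :
    ∑ J, stepFun i₀ i₁ K v₀ va vb vab x y J =
      v₀ + (va + (vb + vab)) + (K.card * x + (2 ^ m - 4 - K.card) * y) := by
  rw [sum_eq_add_sum_otherSets h, stepFun_empty, stepFun_left, stepFun_right _ _ _ _ _ _ _ h,
    stepFun_pair _ _ _ _ _ _ _ h,
    Finset.sum_congr rfl fun J hJ => stepFun_other K v₀ va vb vab x y hJ, ← Finset.sum_sdiff hK,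
    Finset.sum_congr rfl fun J hJ => if_neg (Finset.mem_sdiff.1 hJ).2,
    Finset.sum_congr rfl fun J hJ => if_pos hJ]
  have hc := card_otherSets h
  rw [Finset.sum_const, Finset.sum_const, Finset.card_sdiff_of_subset hK, smul_eq_mul, smul_eq_mul,
    show (otherSets i₀ i₁).card = 2 ^ m - 4 by omega, add_comm (K.card * x)]

theorem sum_mem_stepFun {n : ℕ} (h : i₀ ≠ i₁) (hn : n ∣ 2 ^ m) (hy : Even y)
    (hxy : (x : ZMod n) = y) (ha : (va + vab : ZMod n) = 2 * y) (hb : (vb + vab : ZMod n) = 2 * y)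
    (i : Fin m) :
    ∑ J, (if i ∈ J then (stepFun i₀ i₁ K v₀ va vb vab x y J : ZMod n) else 0) = 0 := by
  have hconst : ∑ J : Finset (Fin m), (if i ∈ J then (y : ZMod n) else 0) = 0 := by
    obtain ⟨z, rfl⟩ := hy
    rw [← Finset.sum_filter, Finset.sum_const, nsmul_eq_mul, ← Nat.cast_mul,
      ZMod.natCast_eq_zero_iff, ← two_mul, ← mul_assoc, mul_comm _ 2, two_mul_card_filter_mem]
    exact hn.mul_right z
  refine Eq.trans ?_ hconst
  rw [sum_eq_add_sum_otherSets h, sum_eq_add_sum_otherSets h, stepFun_empty,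
    stepFun_left, stepFun_right _ _ _ _ _ _ _ h, stepFun_pair _ _ _ _ _ _ _ h]
  congr 1
  · have h' := h.symm
    by_cases h0 : i = i₀
    · subst h0
      simp [h, ha, two_mul]
    · by_cases h1 : i = i₁
      · subst h1
        simp [h', hb, two_mul]
      · simp [h0, h1]
  · refine Finset.sum_congr rfl fun J hJ => ?_
    rw [stepFun_other K v₀ va vb vab x y hJ]
    split_ifs <;> simp [hxy]

end StepFun

variable {n : ℕ}

theorem exists_zeroSum_near_top (h : i₀ ≠ i₁) (hn : 4 ≤ n) (hnm : n ∣ 2 ^ m) (hm : 4 ≤ 2 ^ m)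
    {k l₀ la lab : ℕ} (hk : k ≤ 2 ^ m - 4) (h₀ : 1 ≤ l₀ ∧ l₀ ≤ n - 1) (ha : 1 ≤ la ∧ la ≤ 2 * n - 2)
    (hab : 1 ≤ lab ∧ lab ≤ 2 * n - 2) (hdvd : n ∣ la + lab + 4) :
    ∃ S : Multiset (Fin (m + 1) → ZMod n),
      Multiset.card S = l₀ + (la + (la + lab)) + (k * (n - 2) + (2 ^ m - 4 - k) * (2 * n - 2)) ∧
      S.sum = 0 ∧ ¬ HasShortZeroSumSubseq S := by
  have hc := card_otherSets h
  obtain ⟨K, hK, rfl⟩ := Finset.exists_subset_card_eq (show k ≤ (otherSets i₀ i₁).card by omega)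
  have hcast : ((2 * n - 2 : ℕ) : ZMod n) = -2 := by
    rw [Nat.cast_sub (by omega)]
    simp
  have hsum : (la + lab : ZMod n) = 2 * ((2 * n - 2 : ℕ) : ZMod n) := by
    have := (ZMod.natCast_eq_zero_iff _ _).2 hdvd
    push_cast at this
    rw [hcast]
    linear_combination this
  rw [← sum_stepFun K l₀ la la lab (n - 2) (2 * n - 2) h hK]
  refine exists_zeroSum_of_layers (by omega) _ (fun _ => n - 1) ?_ (fun _ => le_rfl) ?_ ?_ ?_
    (sum_mem_stepFun K _ _ _ _ _ _ h hnm ⟨n - 1, by omega⟩ ?_ hsum hsum)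
  · intro J
    unfold stepFun
    split_ifs <;> omega
  · intro J
    unfold stepFun
    split_ifs <;> omega
  · rw [stepFun_empty]
    exact h₀.2
  · have h2 : ((2 ^ m : ℕ) : ZMod n) = 0 := (ZMod.natCast_eq_zero_iff _ _).2 hnm
    push_cast at h2
    simp [h2]
  · rw [hcast, Nat.cast_sub (by omega)]
    simp

theorem exists_zeroSum_near_bottom (h : i₀ ≠ i₁) (hn : 4 ≤ n) (hnm : n ∣ 2 ^ m) (hm : 4 ≤ 2 ^ m)
    {k j a : ℕ} (hk : k ≤ 2 ^ m - 4) (hj : 1 ≤ j ∧ j ≤ n - 1) (ha : 1 ≤ a ∧ a ≤ n - 1) :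
    ∃ S : Multiset (Fin (m + 1) → ZMod n), Multiset.card S = k * n + n + a + j ∧
      S.sum = 0 ∧ ¬ HasShortZeroSumSubseq S := by
  have hc := card_otherSets h
  obtain ⟨K, hK, rfl⟩ := Finset.exists_subset_card_eq (show k ≤ (otherSets i₀ i₁).card by omega)
  have : NeZero n := ⟨by omega⟩
  have hsum : (a + (n - a : ℕ) : ZMod n) = 2 * (0 : ℕ) := by
    rw [Nat.cast_sub (by omega)]
    simp
  have hcard : ∑ J, stepFun i₀ i₁ K j a a (n - a) n 0 J = K.card * n + n + a + j := by
    rw [sum_stepFun K _ _ _ _ _ _ h hK]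
    omega
  have hval := ZMod.val_lt (1 - K.card : ZMod n)
  rw [← hcard]
  refine exists_zeroSum_of_layers (by omega) _
    (stepFun i₀ i₁ K (n - 1) (1 - K.card : ZMod n).val 0 0 1 0) ?_ ?_ ?_ ?_ ?_
    (sum_mem_stepFun K _ _ _ _ _ _ h hnm (by simp) (by simp) hsum hsum)
  · intro J
    unfold stepFun
    split_ifs <;> omega
  · intro J
    unfold stepFun
    split_ifs <;> omega
  · intro J
    unfold stepFun
    split_ifs <;> omega
  · rw [stepFun_empty, stepFun_empty]
    exact hj.2
  · rw [← Nat.cast_sum, sum_stepFun K _ _ _ _ _ _ h hK]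
    push_cast [Nat.cast_sub (show 1 ≤ n by omega)]
    simp
    ring

theorem exists_mul_add_of_le {M n b s : ℕ} (hn : 4 ≤ n) (hM : 4 ≤ M) (hb : 1 ≤ b ∧ b ≤ n - 1)
    (hs : n + b ≤ s) (hs' : s + 2 ≤ (M - 1) * n) :
    ∃ k u, k ≤ M - 4 ∧ b ≤ u ∧ u ≤ 2 * n - 2 ∧ s = k * n + n + u := by
  obtain ⟨M, rfl⟩ : ∃ M', M = M' + 4 := ⟨M - 4, by omega⟩
  have e : (M + 4 - 1) * n = M * n + 3 * n := by
    rw [show M + 4 - 1 = M + 3 by omega]; ring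
  rw [e] at hs'
  rcases le_or_gt s (M * n + n + b) with h | h
  · refine ⟨(s - n - b) / n, b + (s - n - b) % n, ?_, by omega, ?_, ?_⟩
    · exact Nat.div_le_of_le_mul (by rw [mul_comm]; simp; omega)
    · have := Nat.mod_lt (s - n - b) (show 0 < n by omega)
      omega
    · have := Nat.div_add_mod' (s - n - b) n
      omega
  · exact ⟨M, s - M * n - n, by omega, by omega, by omega, by omega⟩

theorem exists_zeroSum_of_card {t : ℕ} (h : i₀ ≠ i₁) (hn : 4 ≤ n) (hnm : n ∣ 2 ^ m)
    (hm : 4 ≤ 2 ^ m) (ht : n + 2 ≤ t) (htN : t ≤ (2 ^ (m + 1) - 1) * (n - 1))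
    (h1 : t ≠ (2 ^ (m + 1) - 1) * (n - 1) - n) (h2 : t ≠ (2 ^ (m + 1) - 1) * (n - 1) - n + 1) :
    ∃ S : Multiset (Fin (m + 1) → ZMod n), Multiset.card S = t ∧
      S.sum = 0 ∧ ¬ HasShortZeroSumSubseq S := by
  have hle := Nat.le_of_dvd (by omega) hnm
  obtain ⟨M, hM⟩ : ∃ M, 2 ^ m = M + 4 := ⟨2 ^ m - 4, by omega⟩
  obtain ⟨p, hp⟩ : ∃ p, n = p + 2 := ⟨n - 2, by omega⟩
  have hN : (2 ^ (m + 1) - 1) * (n - 1) = 2 * (M * p) + 2 * M + 7 * p + 7 := by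
    rw [pow_succ, hM, hp, show (M + 4) * 2 - 1 = 2 * M + 7 by omega,
      show p + 2 - 1 = p + 1 by omega]
    ring
  have hMn : M * n = M * p + 2 * M := by rw [hp]; ring
  rw [hN] at htN h1 h2
  have hM3 : (2 ^ m - 1) * n = M * n + 3 * n := by
    rw [hM, show M + 4 - 1 = M + 3 by omega]; ring
  have htop : ∀ k ≤ M, k * (n - 2) + (2 ^ m - 4 - k) * (2 * n - 2) + k * n =
      2 * (M * p) + 2 * M := by
    intro k hk
    obtain ⟨q, rfl⟩ := Nat.exists_eq_add_of_le hk
    rw [hM, hp, show p + 2 - 2 = p by omega, show k + q + 4 - 4 - k = q by omega,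
      show 2 * (p + 2) - 2 = 2 * p + 2 by omega]
    ring
  by_cases hA : 2 * (M * p) + 2 * M + 7 * p + 7 ≤ t + (n - 2)
  · obtain ⟨S, hS, hS'⟩ := exists_zeroSum_near_top (n := n) h hn hnm hm (k := 0)
      (l₀ := n - 1 - (2 * (M * p) + 2 * M + 7 * p + 7 - t)) (la := 2 * n - 2) (lab := 2 * n - 2)
      (by omega) (by omega) (by omega) (by omega) ⟨4, by omega⟩
    refine ⟨S, ?_, hS'⟩
    have := htop 0 (by omega)
    omega
  by_cases hB : t + 2 ≤ (2 ^ m - 1) * n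
  · obtain ⟨k, u, hk, hu, hu', rfl⟩ := exists_mul_add_of_le (b := 2) hn hm (by omega) ht hB
    obtain ⟨S, hS, hS'⟩ := exists_zeroSum_near_bottom h hn hnm hm hk (j := u - min (u - 1) (n - 1))
      (a := min (u - 1) (n - 1)) (by omega) (by omega)
    exact ⟨S, by omega, hS'⟩
  · obtain ⟨k, u, hk, hu, hu', hs⟩ := exists_mul_add_of_le (b := 1)
      (s := 2 * (M * p) + 2 * M + 7 * p + 7 - t) hn hm (by omega) (by omega) (by omega)
    obtain ⟨S, hS, hS'⟩ := exists_zeroSum_near_top (n := n) h hn hnm hm hk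
      (l₀ := n - 1 - (u - min u n)) (la := 2 * n - 2 - min u n) (lab := n - 2 + min u n)
      (by omega) (by omega) (by omega) ⟨3, by omega⟩
    refine ⟨S, ?_, hS'⟩
    have := htop k (by omega)
    omega

end Construction

theorem stmt_12 (n r α : ℕ) (hn : 3 ≤ n) (hr : 3 ≤ r)
    (hα_lt : α ≤ n - 1) (hα_cong : (α : ZMod n) = -(2 ^ (r - 1) : ZMod n))
    (hα_eq : α = 0) :
    C0 (Fin r → ZMod n) ⊆
      {(2 ^ r - 1) * (n - 1) - n, (2 ^ r - 1) * (n - 1) - n + 1} := by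
  subst hα_eq
  obtain ⟨m, rfl⟩ : ∃ m, r = m + 1 := ⟨r - 1, by omega⟩
  have hnm : n ∣ 2 ^ m := by
    rw [← ZMod.natCast_eq_zero_iff]
    simpa [eq_comm] using hα_cong
  obtain ⟨k, -, rfl⟩ := (Nat.dvd_prime_pow Nat.prime_two).1 hnm
  have hk : 2 ≤ k := by
    by_contra! h
    interval_cases k <;> omega
  have hn4 : 4 ≤ 2 ^ k := Nat.pow_le_pow_right (n := 2) two_pos hk
  have hm4 : 4 ≤ 2 ^ m := Nat.pow_le_pow_right (n := 2) two_pos (by omega : 2 ≤ m)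
  rintro t ⟨hDt, htη, ht⟩
  have hD := lt_davenport (k := k) (m := m) (by omega) (by omega)
  have hη := etaConst_le (k := k) (r := m + 1) (by omega)
  by_contra hmem
  simp only [Set.mem_insert_iff, Set.mem_singleton_iff, not_or] at hmem
  obtain ⟨S, hS, hS0, hS'⟩ := exists_zeroSum_of_card (i₀ := (⟨0, by omega⟩ : Fin m))
    (i₁ := ⟨1, by omega⟩) (by simp) hn4 hnm hm4 (t := t) (by omega) (by omega) hmem.1 hmem.2
  exact hS' (ht S hS hS0)
end
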